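/- arXiv:1406.3720 — 12 statements merged into one kernel-verified Lean document; each statement's English description precedes it below -/
import Mathlib

section
/- There exist constants θ₁ > 0 and θ₂ > 0, depending only on the problem data, such that for every λ ∈ D the following global error bound holds: ‖λ − λ̄‖_W ≤ κ(T(λ)) · ‖∇⁺d(λ)‖_W, where λ̄ = [λ]_{Λ*}^W, T(λ) = max_{λ* ∈ Λ*} ‖λ − λ*‖_W, N = ‖∇d*‖_{W⁻¹} with ∇d* the common value of ∇d on Λ*, and κ(t) = (4/σ_f̃)·θ₁² + 12θ₂²·(2t² + 2N²)·(1 + 6θ₁²/σ_f̃). -/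
noncomputable section
open Finset

/-- Euclidean inner product on `Fin m → ℝ`. -/
def ipV {m : ℕ} (x y : Fin m → ℝ) : ℝ := ∑ i, x i * y i

/-- Euclidean norm on `Fin m → ℝ`. -/
def eNorm {m : ℕ} (x : Fin m → ℝ) : ℝ := Real.sqrt (∑ i, (x i) ^ 2)

/-- Weighted norm `‖x‖_W` for a diagonal weight vector `w` (positive entries). -/
def wNorm {m : ℕ} (w : Fin m → ℝ) (x : Fin m → ℝ) : ℝ := Real.sqrt (∑ i, w i * (x i) ^ 2)

/-- Weighted norm `‖x‖_W = √(xᵀWx)` for a matrix `W`. -/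
def mNorm {m : ℕ} (W : Matrix (Fin m) (Fin m) ℝ) (x : Fin m → ℝ) : ℝ :=
  Real.sqrt (ipV x (W.mulVec x))

/-- The set `D = ℝ^p × ℝ^q_{≥0}` inside `Fin (p+q) → ℝ`. -/
def Dpq (p q : ℕ) : Set (Fin (p + q) → ℝ) := {x | ∀ i : Fin (p + q), p ≤ (i : ℕ) → 0 ≤ x i}

/-- Componentwise (Euclidean, equivalently `W`-weighted for diagonal `W`) projection onto
`Dpq p q`: the first `p` coordinates are unchanged, positive parts on the last `q`. -/
def projDpq (p q : ℕ) (v : Fin (p + q) → ℝ) : Fin (p + q) → ℝ :=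
  fun i => if (i : ℕ) < p then v i else max (v i) 0

lemma wNorm_nonneg' {m : ℕ} (w x : Fin m → ℝ) : 0 ≤ wNorm w x := Real.sqrt_nonneg _

lemma wNorm_sq' {m : ℕ} (w x : Fin m → ℝ) (hw : ∀ i, 0 < w i) :
    wNorm w x ^ 2 = ∑ i, w i * x i ^ 2 := by
  unfold wNorm
  rw [Real.sq_sqrt]
  exact Finset.sum_nonneg fun i _ => mul_nonneg (hw i).le (sq_nonneg _)

lemma eNorm_sq' {m : ℕ} (x : Fin m → ℝ) : eNorm x ^ 2 = ∑ i, x i ^ 2 := by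
  unfold eNorm
  rw [Real.sq_sqrt]
  exact Finset.sum_nonneg fun i _ => sq_nonneg _

lemma wNorm_neg' {m : ℕ} (w x : Fin m → ℝ) : wNorm w (-x) = wNorm w x := by
  unfold wNorm; simp

lemma wNorm_le_sup {m : ℕ} (w : Fin m → ℝ) (hw : ∀ i, 0 < w i) :
    ∃ C : ℝ, 0 < C ∧ ∀ x : Fin m → ℝ, wNorm w x ≤ C * ‖x‖ := by
  refine ⟨Real.sqrt (∑ i, w i) + 1, by positivity, fun x => ?_⟩
  have h0 : 0 ≤ ∑ i, w i := Finset.sum_nonneg fun i _ => (hw i).le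
  have : wNorm w x ≤ Real.sqrt (∑ i, w i) * ‖x‖ := by
    unfold wNorm
    apply Real.sqrt_le_iff.2
    refine ⟨by positivity, ?_⟩
    rw [mul_pow, Real.sq_sqrt h0, Finset.sum_mul]
    apply Finset.sum_le_sum
    intro i _
    apply mul_le_mul_of_nonneg_left _ (hw i).le
    have := norm_le_pi_norm x i
    rw [← sq_abs (x i)]
    exact pow_le_pow_left₀ (abs_nonneg _) this 2
  nlinarith [norm_nonneg x]

lemma cs_w {m : ℕ} (w a b : Fin m → ℝ) (hw : ∀ i, 0 < w i) :
    ∑ i, w i * a i * b i ≤ wNorm w a * wNorm w b := by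
  have h := Real.sum_mul_le_sqrt_mul_sqrt Finset.univ
    (fun i => Real.sqrt (w i) * a i) (fun i => Real.sqrt (w i) * b i)
  have e1 : ∀ i, (Real.sqrt (w i) * a i) * (Real.sqrt (w i) * b i) = w i * a i * b i := by
    intro i
    have := Real.mul_self_sqrt (hw i).le
    linear_combination (a i * b i) * this
  have e2 : ∀ c : Fin m → ℝ, ∀ i, (Real.sqrt (w i) * c i) ^ 2 = w i * c i ^ 2 := by
    intro c i
    rw [mul_pow, Real.sq_sqrt (hw i).le]
  simp only [e1, e2] at h
  exact h

lemma cs_dual {m : ℕ} (w a b : Fin m → ℝ) (hw : ∀ i, 0 < w i) :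
    ipV a b ≤ wNorm (fun i => (w i)⁻¹) a * wNorm w b := by
  have h := Real.sum_mul_le_sqrt_mul_sqrt Finset.univ
    (fun i => (Real.sqrt (w i))⁻¹ * a i) (fun i => Real.sqrt (w i) * b i)
  have e1 : ∀ i, ((Real.sqrt (w i))⁻¹ * a i) * (Real.sqrt (w i) * b i) = a i * b i := by
    intro i
    have := (Real.sqrt_pos.2 (hw i)).ne'
    field_simp
  have e2 : ∀ i, (Real.sqrt (w i) * b i) ^ 2 = w i * b i ^ 2 := by
    intro i
    rw [mul_pow, Real.sq_sqrt (hw i).le]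
  have e3 : ∀ i, ((Real.sqrt (w i))⁻¹ * a i) ^ 2 = (w i)⁻¹ * a i ^ 2 := by
    intro i
    rw [mul_pow, inv_pow, Real.sq_sqrt (hw i).le]
  simp only [e1, e2, e3] at h
  exact h

/-- One sign pattern: if the closed cone meets the kernel only in zero, then the map is
bounded below on it. -/
lemma cone_bound {m : ℕ} {E : Type*} [NormedAddCommGroup E] [NormedSpace ℝ E]
    (A : (Fin m → ℝ) →L[ℝ] E) (s : Fin m → SignType) :
    ∃ C : ℝ, 0 < C ∧ ((∀ u : Fin m → ℝ, (∀ i, u i = (s i : ℝ) * |u i|) → A u = 0 → u = 0) →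
      ∀ u : Fin m → ℝ, (∀ i, u i = (s i : ℝ) * |u i|) → ‖u‖ ≤ C * ‖A u‖) := by
  by_cases H : ∀ u : Fin m → ℝ, (∀ i, u i = (s i : ℝ) * |u i|) → A u = 0 → u = 0
  swap
  · exact ⟨1, one_pos, fun h => absurd h H⟩
  let K : Set (Fin m → ℝ) := {u | ∀ i, u i = (s i : ℝ) * |u i|}
  have hK : IsClosed K := by
    have : K = ⋂ i, {u | u i = (s i : ℝ) * |u i|} := by ext; simp [K]
    rw [this]
    exact isClosed_iInter fun i => isClosed_eq (by fun_prop) (by fun_prop)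
  have hS : IsCompact (Metric.sphere (0 : Fin m → ℝ) 1 ∩ K) :=
    (isCompact_sphere _ _).inter_right hK
  rcases (Metric.sphere (0 : Fin m → ℝ) 1 ∩ K).eq_empty_or_nonempty with he | hne
  · refine ⟨1, one_pos, fun _ u hu => ?_⟩
    by_cases h0 : u = 0
    · simp [h0]
    · exfalso
      have hn : 0 < ‖u‖ := norm_pos_iff.2 h0
      have : (‖u‖⁻¹ • u) ∈ Metric.sphere (0 : Fin m → ℝ) 1 ∩ K := by
        refine ⟨by simp [norm_smul, hn.ne'], fun i => ?_⟩
        simp only [Pi.smul_apply, smul_eq_mul, abs_mul, abs_of_pos (inv_pos.2 hn)]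
        have := hu i
        linear_combination ‖u‖⁻¹ * this
      rw [he] at this
      exact this
  · obtain ⟨z, hz, hmin⟩ := hS.exists_isMinOn hne
      (f := fun u => ‖A u‖) (by fun_prop)
    have hzpos : 0 < ‖A z‖ := by
      rw [norm_pos_iff]
      intro h
      have := H z hz.2 h
      have h1 := hz.1
      rw [this] at h1
      simp at h1
    refine ⟨‖A z‖⁻¹, inv_pos.2 hzpos, fun _ u hu => ?_⟩
    by_cases h0 : u = 0
    · simp [h0]
    · have hn : 0 < ‖u‖ := norm_pos_iff.2 h0
      have : (‖u‖⁻¹ • u) ∈ Metric.sphere (0 : Fin m → ℝ) 1 ∩ K := by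
        refine ⟨by simp [norm_smul, hn.ne'], fun i => ?_⟩
        simp only [Pi.smul_apply, smul_eq_mul, abs_mul, abs_of_pos (inv_pos.2 hn)]
        have := hu i
        linear_combination ‖u‖⁻¹ * this
      have h2 : ‖A z‖ ≤ ‖A (‖u‖⁻¹ • u)‖ := hmin this
      rw [map_smul, norm_smul, norm_inv, norm_norm, inv_mul_eq_div, le_div_iff₀ hn] at h2
      rw [inv_mul_eq_div, le_div_iff₀ hzpos]
      linarith

/-- Conformal Hoffman bound. -/
lemma conformal_bound {m : ℕ} {E : Type*} [NormedAddCommGroup E] [NormedSpace ℝ E]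
    (A : (Fin m → ℝ) →L[ℝ] E) :
    ∃ C : ℝ, 0 < C ∧ ∀ v : Fin m → ℝ, ∃ v' : Fin m → ℝ, A v' = A v ∧
      (∀ i, min (v i) 0 ≤ v' i ∧ v' i ≤ max (v i) 0) ∧ ‖v'‖ ≤ C * ‖A v‖ := by
  choose C hC hCb using cone_bound A
  have hsum : ∀ s, C s ≤ ∑ t, C t := fun s =>
    Finset.single_le_sum (f := C) (fun t _ => (hC t).le) (Finset.mem_univ s)
  refine ⟨∑ s, C s, Finset.sum_pos (fun s _ => hC s) Finset.univ_nonempty, fun v => ?_⟩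
  let B : Set (Fin m → ℝ) :=
    Set.Icc (fun i => min (v i) 0) (fun i => max (v i) 0) ∩ A ⁻¹' {A v}
  have hB : IsCompact B := isCompact_Icc.inter_right
    (isClosed_singleton.preimage A.continuous)
  have hBne : B.Nonempty :=
    ⟨v, ⟨⟨fun i => min_le_left _ _, fun i => le_max_left _ _⟩, rfl⟩⟩
  obtain ⟨z, hz, hmin⟩ := hB.exists_isMinOn hBne (f := fun u => ∑ i, |u i|) (by fun_prop)
  have hzA : A z = A v := hz.2
  refine ⟨z, hzA, fun i => ⟨hz.1.1 i, hz.1.2 i⟩, ?_⟩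
  have key : ∀ u : Fin m → ℝ,
      (∀ i, u i = (SignType.sign (z i) : ℝ) * |u i|) → A u = 0 → u = 0 := by
    intro u hu hAu
    have hev : ∀ᶠ t in nhdsWithin (0 : ℝ) (Set.Ioi 0), ∀ i, t * |u i| ≤ |z i| := by
      rw [Filter.eventually_all]
      intro i
      by_cases hzi : z i = 0
      · have : u i = 0 := by rw [hu i, hzi]; simp
        simp [this, hzi]
      · have hc : Filter.Tendsto (fun t : ℝ => t * |u i|) (nhdsWithin (0 : ℝ) (Set.Ioi 0))
            (nhds (0 * |u i|)) :=
          ((continuous_id.mul continuous_const).tendsto 0).mono_left nhdsWithin_le_nhds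
        rw [zero_mul] at hc
        exact (hc.eventually (gt_mem_nhds (abs_pos.2 hzi))).mono fun t ht => le_of_lt ht
    obtain ⟨t, ht, ht0⟩ := (hev.and self_mem_nhdsWithin).exists
    have ht0 : 0 < t := ht0
    have hcoord : ∀ i, |z i - t * u i| = |z i| - t * |u i| ∧
        min (z i) 0 ≤ z i - t * u i ∧ z i - t * u i ≤ max (z i) 0 := by
      intro i
      have h1 := ht i
      have h2 := hu i
      have h3 : 0 ≤ t * |u i| := by positivity
      rcases lt_trichotomy (z i) 0 with h | h | h
      · rw [sign_neg h] at h2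
        simp at h2
        rw [abs_of_neg h] at h1 ⊢
        have h4 : t * u i = - (t * |u i|) := by linear_combination t * h2
        rw [h4, min_eq_left h.le, max_eq_right h.le]
        refine ⟨?_, by linarith, by linarith⟩
        rw [abs_of_nonpos (by linarith)]; ring
      · rw [h] at h2
        simp at h2
        simp [h, h2]
      · rw [sign_pos h] at h2
        simp at h2
        rw [abs_of_pos h] at h1 ⊢
        have h4 : t * u i = t * |u i| := by linear_combination t * h2
        rw [h4, min_eq_right h.le, max_eq_left h.le]
        refine ⟨?_, by linarith, by linarith⟩
        rw [abs_of_nonneg (by linarith)]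
    have hmem : (z - t • u) ∈ B := by
      refine ⟨⟨fun i => ?_, fun i => ?_⟩, ?_⟩
      · have h1 := (hcoord i).2.1
        have h2 : min (v i) 0 ≤ z i := hz.1.1 i
        simp only [Pi.sub_apply, Pi.smul_apply, smul_eq_mul]
        exact le_trans (le_min h2 (min_le_right _ _)) h1
      · have h1 := (hcoord i).2.2
        have h2 : z i ≤ max (v i) 0 := hz.1.2 i
        simp only [Pi.sub_apply, Pi.smul_apply, smul_eq_mul]
        exact le_trans h1 (max_le h2 (le_max_right _ _))
      · simp [hAu, hzA]
    have h5 : ∑ i, |z i| ≤ ∑ i, |(z - t • u) i| := hmin hmem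
    simp only [Pi.sub_apply, Pi.smul_apply, smul_eq_mul, fun i => (hcoord i).1,
      Finset.sum_sub_distrib, ← Finset.mul_sum] at h5
    have h6 : 0 ≤ ∑ i, |u i| := Finset.sum_nonneg fun i _ => abs_nonneg _
    have h7 : ∑ i, |u i| = 0 := by
      by_contra hne
      have : 0 < ∑ i, |u i| := lt_of_le_of_ne h6 (Ne.symm hne)
      nlinarith [mul_pos ht0 this]
    rw [Finset.sum_eq_zero_iff_of_nonneg (fun i _ => abs_nonneg _)] at h7
    ext i
    exact abs_eq_zero.1 (h7 i (Finset.mem_univ i))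
  have h8 := hCb (fun i => SignType.sign (z i)) key z
    (fun i => (sign_mul_abs (z i)).symm)
  rw [hzA] at h8
  exact h8.trans (mul_le_mul_of_nonneg_right (hsum _) (norm_nonneg _))

lemma ipV_add {m : ℕ} (a x y : Fin m → ℝ) : ipV a (x + y) = ipV a x + ipV a y := by
  simp [ipV, mul_add, Finset.sum_add_distrib]

lemma ipV_sub {m : ℕ} (a x y : Fin m → ℝ) : ipV a (x - y) = ipV a x - ipV a y := by
  simp [ipV, mul_sub, Finset.sum_sub_distrib]

lemma ipV_smul {m : ℕ} (a x : Fin m → ℝ) (c : ℝ) : ipV a (c • x) = c * ipV a x := by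
  simp only [ipV, Finset.mul_sum, Pi.smul_apply, smul_eq_mul]
  exact Finset.sum_congr rfl fun i _ => by ring

/-- right slope tends to the directional derivative -/
lemma slope_lim {m : ℕ} (d : (Fin m → ℝ) → ℝ) (hdd : Differentiable ℝ d) (x v : Fin m → ℝ) :
    Filter.Tendsto (fun t : ℝ => t⁻¹ * (d (x + t • v) - d x)) (nhdsWithin 0 (Set.Ioi 0))
      (nhds (fderiv ℝ d x v)) := by
  have h1 : HasDerivAt (fun t : ℝ => x + t • v) v 0 := by
    simpa using ((hasDerivAt_id (0 : ℝ)).smul_const v).const_add x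
  have h2 : HasFDerivAt d (fderiv ℝ d x) (x + (0 : ℝ) • v) := by
    simpa using (hdd x).hasFDerivAt
  have h3 : HasDerivAt (fun t : ℝ => d (x + t • v)) (fderiv ℝ d x v) 0 :=
    h2.comp_hasDerivAt (0 : ℝ) h1
  have h4 := h3.hasDerivWithinAt (s := Set.Ioi 0)
  rw [hasDerivWithinAt_iff_tendsto_slope' (by simp)] at h4
  refine h4.congr fun t => ?_
  simp [slope_def_field, div_eq_inv_mul]

lemma eNorm_sq_comb {m : ℕ} (x y : Fin m → ℝ) (t : ℝ) :
    eNorm ((1 - t) • x + t • y) ^ 2 =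
      (1 - t) * eNorm x ^ 2 + t * eNorm y ^ 2 - t * (1 - t) * eNorm (x - y) ^ 2 := by
  simp only [eNorm_sq', Finset.mul_sum, ← Finset.sum_add_distrib, ← Finset.sum_sub_distrib]
  refine Finset.sum_congr rfl fun i _ => ?_
  simp
  ring

lemma abs_le_eNorm {m : ℕ} (x : Fin m → ℝ) : ‖x‖ ≤ eNorm x := by
  unfold eNorm
  rw [pi_norm_le_iff_of_nonneg (Real.sqrt_nonneg _)]
  intro i
  apply Real.le_sqrt_of_sq_le
  rw [Real.norm_eq_abs, sq_abs]
  exact Finset.single_le_sum (f := fun i => x i ^ 2) (fun t _ => sq_nonneg _) (Finset.mem_univ i)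

lemma projDpq_mem (p q : ℕ) (v : Fin (p + q) → ℝ) : projDpq p q v ∈ Dpq p q := by
  intro i hi
  simp [projDpq, not_lt.2 hi]

lemma projDpq_ineq (p q : ℕ) (W : Fin (p + q) → ℝ) (hW : ∀ i, 0 < W i)
    (l a mu : Fin (p + q) → ℝ) (hmu : mu ∈ Dpq p q) :
    ipV a (mu - projDpq p q (l + fun i => (W i)⁻¹ * a i)) ≤
      ∑ i, W i * (projDpq p q (l + fun i => (W i)⁻¹ * a i) - l) i *
        (mu - projDpq p q (l + fun i => (W i)⁻¹ * a i)) i := by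
  unfold ipV
  apply Finset.sum_le_sum
  intro i _
  have hWi := hW i
  have e : W i * (W i)⁻¹ = 1 := mul_inv_cancel₀ hWi.ne'
  simp only [projDpq, Pi.sub_apply, Pi.add_apply]
  split_ifs with h
  · apply le_of_eq
    linear_combination -(a i * (mu i - (l i + (W i)⁻¹ * a i))) * e
  · have hm := hmu i (not_lt.1 h)
    rcases le_total 0 (l i + (W i)⁻¹ * a i) with h0 | h0
    · rw [max_eq_left h0]
      apply le_of_eq
      linear_combination -(a i * (mu i - (l i + (W i)⁻¹ * a i))) * e
    · rw [max_eq_right h0]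
      have h1 := mul_nonneg hWi.le (neg_nonneg.2 h0)
      have h2 : W i * -(l i + (W i)⁻¹ * a i) = -(W i * l i) - a i := by
        linear_combination -(a i) * e
      rw [h2] at h1
      nlinarith [mul_nonneg h1 hm]

set_option maxHeartbeats 2000000

/-- Theorem: global error bound for the dual problem.
There exist constants `θ₁, θ₂ > 0` such that for every `λ ∈ D`,
`‖λ − λ̄‖_W ≤ κ(T(λ)) ‖∇⁺d(λ)‖_W`, with
`κ(t) = (4/σ)θ₁² + 12θ₂²(2t² + 2N²)(1 + 6θ₁²/σ)`. -/
theorem global_error_bound_dual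
    (n p q : ℕ) (σ : ℝ) (hσ : 0 < σ)
    (ftil : (Fin n → ℝ) → ℝ)
    (hconv : ConvexOn ℝ Set.univ (fun x => ftil x - σ / 2 * (eNorm x) ^ 2))
    (hdiff : Differentiable ℝ ftil)
    (G : Matrix (Fin (p + q)) (Fin n) ℝ) (g : Fin (p + q) → ℝ)
    (d : (Fin (p + q) → ℝ) → ℝ)
    (hd : ∀ lam, d lam = -ftil (-(G.transpose.mulVec lam)) - ipV g lam)
    (gradD : (Fin (p + q) → ℝ) → (Fin (p + q) → ℝ))
    (hgradD : ∀ lam v, fderiv ℝ d lam v = ipV (gradD lam) v)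
    (W : Fin (p + q) → ℝ) (hW : ∀ i, 0 < W i)
    (hdescent : ∀ lam ∈ Dpq p q, ∀ mu ∈ Dpq p q,
      d lam ≥ d mu + ipV (gradD mu) (lam - mu) - 1 / 2 * (wNorm W (lam - mu)) ^ 2)
    (Lstar : Set (Fin (p + q) → ℝ))
    (hLstar : ∀ l, l ∈ Lstar ↔ (l ∈ Dpq p q ∧ ∀ mu ∈ Dpq p q, d mu ≤ d l))
    (hLne : Lstar.Nonempty) (hLbd : Bornology.IsBounded Lstar)
    (gdstar : Fin (p + q) → ℝ) (hgdstar : ∀ l ∈ Lstar, gradD l = gdstar)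
    (projLs : (Fin (p + q) → ℝ) → (Fin (p + q) → ℝ))
    (hprojLs : ∀ x, projLs x ∈ Lstar ∧ ∀ s ∈ Lstar, wNorm W (projLs x - x) ≤ wNorm W (s - x)) :
    ∃ θ₁ > (0 : ℝ), ∃ θ₂ > (0 : ℝ), ∀ lam ∈ Dpq p q,
      wNorm W (lam - projLs lam) ≤
        (4 / σ * θ₁ ^ 2 +
          12 * θ₂ ^ 2 *
            (2 * (sSup ((fun l => wNorm W (lam - l)) '' Lstar)) ^ 2 +
              2 * (wNorm (fun i => (W i)⁻¹) gdstar) ^ 2) *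
            (1 + 6 * θ₁ ^ 2 / σ)) *
          wNorm W (projDpq p q (lam + fun i => (W i)⁻¹ * gradD lam i) - lam) := by
  classical
  set M : (Fin (p + q) → ℝ) →ₗ[ℝ] (Fin n → ℝ) := G.transpose.mulVecLin with hM
  have hd' : ∀ lam, d lam = -ftil (-(M lam)) - ipV g lam := hd
  have hdd : Differentiable ℝ d := by
    have : d = fun lam => -ftil (-(M.toContinuousLinearMap lam)) - ipV g lam := funext hd'
    rw [this]
    have h1 : Differentiable ℝ (fun lam => ipV g lam) := by unfold ipV; fun_prop
    have h2 : Differentiable ℝ (fun lam => ftil (-(M.toContinuousLinearMap lam))) :=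
      hdiff.comp (M.toContinuousLinearMap.differentiable.neg)
    exact h2.neg.sub h1
  have hcc : ∀ x y : Fin (p + q) → ℝ, ∀ t : ℝ, 0 ≤ t → t ≤ 1 →
      (1 - t) * d x + t * d y + σ / 2 * (t * (1 - t)) * eNorm (M (y - x)) ^ 2
        ≤ d (x + t • (y - x)) := by
    intro x y t ht0 ht1
    have h := hconv.2 (Set.mem_univ (-(M x))) (Set.mem_univ (-(M y)))
      (sub_nonneg.2 ht1) ht0 (by ring)
    have e1 : (1 - t) • -(M x) + t • -(M y) = -(M (x + t • (y - x))) := by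
      simp only [map_add, map_smul, map_sub]
      module
    have e2 := eNorm_sq_comb (-(M x)) (-(M y)) t
    have e3 : -(M x) - -(M y) = M (y - x) := by simp only [map_sub]; module
    simp only [smul_eq_mul] at h
    rw [e2, e1, e3] at h
    rw [hd' x, hd' y, hd' (x + t • (y - x)), ipV_add, ipV_smul, ipV_sub]
    linarith
  have hsc : ∀ x y : Fin (p + q) → ℝ,
      d y ≤ d x + ipV (gradD x) (y - x) - σ / 2 * eNorm (M (y - x)) ^ 2 := by
    intro x y
    have h1 := slope_lim d hdd x (y - x)
    rw [hgradD] at h1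
    have h2 : Filter.Tendsto (fun t : ℝ => d y - d x + σ / 2 * (1 - t) * eNorm (M (y - x)) ^ 2)
        (nhdsWithin 0 (Set.Ioi 0))
        (nhds (d y - d x + σ / 2 * (1 - 0) * eNorm (M (y - x)) ^ 2)) := by
      have : Continuous (fun t : ℝ => d y - d x + σ / 2 * (1 - t) * eNorm (M (y - x)) ^ 2) := by
        fun_prop
      exact (this.tendsto 0).mono_left nhdsWithin_le_nhds
    have h3 := le_of_tendsto_of_tendsto h2 h1 (by
      filter_upwards [Ioo_mem_nhdsGT (zero_lt_one' ℝ)] with t ht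
      have := hcc x y t ht.1.le ht.2.le
      rw [inv_mul_eq_div, le_div_iff₀ ht.1]
      linarith)
    linarith
  have hopt : ∀ l ∈ Lstar, ∀ mu ∈ Dpq p q, ipV gdstar (mu - l) ≤ 0 := by
    intro l hl mu hmu
    have hl' := (hLstar l).1 hl
    have h1 := slope_lim d hdd l (mu - l)
    rw [hgradD, hgdstar l hl] at h1
    refine le_of_tendsto h1 ?_
    filter_upwards [Ioo_mem_nhdsGT (zero_lt_one' ℝ)] with t ht
    have : l + t • (mu - l) ∈ Dpq p q := by
      intro i hi
      have a1 := hl'.1 i hi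
      have a2 := hmu i hi
      simp only [Pi.add_apply, Pi.smul_apply, Pi.sub_apply, smul_eq_mul]
      nlinarith [mul_nonneg ht.1.le a2, mul_nonneg (sub_nonneg.2 ht.2.le) a1]
    have h2 := hl'.2 _ this
    exact mul_nonpos_of_nonneg_of_nonpos (inv_nonneg.2 ht.1.le) (by linarith)
  have hchar : ∀ l ∈ Lstar, ∀ s ∈ Dpq p q, M s = M l → ipV gdstar s = ipV gdstar l →
      s ∈ Lstar := by
    intro l hl s hs hMs hg
    have hl' := (hLstar l).1 hl
    refine (hLstar s).2 ⟨hs, fun mu hmu => (hl'.2 mu hmu).trans ?_⟩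
    have h1 := hsc l (l - (s - l))
    rw [hgdstar l hl] at h1
    have e1 : M (l - (s - l)) = M l := by simp [hMs]
    have e2 : M (l - (s - l) - l) = 0 := by simp [hMs]
    have e3 : eNorm (0 : Fin n → ℝ) = 0 := by simp [eNorm]
    rw [hd' l, hd' (l - (s - l)), e1, e2, e3] at h1
    rw [hd' l, hd' s, hMs]
    simp only [ipV_sub] at h1
    linarith
  let Phi : (Fin (p + q) → ℝ) →ₗ[ℝ] ℝ :=
    { toFun := ipV gdstar
      map_add' := ipV_add _
      map_smul' := fun c x => by simp [ipV_smul] }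
  let A : (Fin (p + q) → ℝ) →L[ℝ] (Fin n → ℝ) × ℝ := (M.prod Phi).toContinuousLinearMap
  have hA : ∀ v, A v = (M v, ipV gdstar v) := fun v => rfl
  obtain ⟨C, hC, hCb⟩ := conformal_bound A
  obtain ⟨C', hC', hCb'⟩ := wNorm_le_sup W hW
  set θ : ℝ := C' * C with hθ
  have hθpos : 0 < θ := mul_pos hC' hC
  refine ⟨Real.sqrt (θ ^ 2 + σ), Real.sqrt_pos.2 (by positivity), θ, hθpos, fun lam hlam => ?_⟩
  rw [Real.sq_sqrt (by positivity)]
  obtain ⟨hbL, hbmin⟩ := hprojLs lam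
  set lb := projLs lam with hlb
  have hbD := ((hLstar lb).1 hbL).1
  set lp := projDpq p q (lam + fun i => (W i)⁻¹ * gradD lam i) with hlp
  have hpD : lp ∈ Dpq p q := projDpq_mem p q _
  set x := wNorm W (lam - lb) with hx
  set r := wNorm W (lp - lam) with hr
  set N := wNorm (fun i => (W i)⁻¹) gdstar with hN
  have hx0 : 0 ≤ x := wNorm_nonneg' _ _
  have hr0 : 0 ≤ r := wNorm_nonneg' _ _
  have hN0 : 0 ≤ N := wNorm_nonneg' _ _
  have hxT : x ≤ sSup ((fun l => wNorm W (lam - l)) '' Lstar) := by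
    apply le_csSup
    · obtain ⟨R, hR⟩ := hLbd.exists_norm_le
      refine ⟨C' * (‖lam‖ + R), ?_⟩
      rintro _ ⟨l, hl, rfl⟩
      refine (hCb' _).trans (mul_le_mul_of_nonneg_left ?_ hC'.le)
      exact (norm_sub_le _ _).trans (by linarith [hR l hl])
    · exact ⟨lb, hbL, rfl⟩
  set T := sSup ((fun l => wNorm W (lam - l)) '' Lstar) with hT
  -- basic inequalities
  have i1 := hdescent lp hpD lam hlam
  rw [← hr] at i1
  have i2 := hsc lam lb
  have i3 := projDpq_ineq p q W hW lam (gradD lam) lb hbD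
  rw [← hlp] at i3
  have i3' : ∑ i, W i * (lp - lam) i * (lb - lp) i ≤ r * x - r ^ 2 := by
    have a1 := cs_w W (lp - lam) (lb - lam) hW
    have a2 := wNorm_sq' W (lp - lam) hW
    have a3 : wNorm W (lb - lam) = x := by rw [← neg_sub lam lb, wNorm_neg']
    rw [a3] at a1
    rw [← hr] at a1 a2
    have a4 : ∑ i, W i * (lp - lam) i * (lb - lp) i =
        ∑ i, W i * (lp - lam) i * (lb - lam) i - ∑ i, W i * (lp - lam) i ^ 2 := by
      rw [← Finset.sum_sub_distrib]
      refine Finset.sum_congr rfl fun i _ => ?_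
      simp only [Pi.sub_apply]
      ring
    rw [a4, ← a2]
    linarith
  have i4 := hsc lb lp
  rw [hgdstar lb hbL] at i4
  have i5 := hopt lb hbL lp hpD
  have i7 := hopt lb hbL lam hlam
  have i6 := cs_dual W gdstar (lp - lam) hW
  rw [← hN, ← hr] at i6
  have e4 : 0 ≤ eNorm (M (lp - lb)) ^ 2 := sq_nonneg _
  set e := eNorm (M (lb - lam)) with he
  have he0 : 0 ≤ e := Real.sqrt_nonneg _
  simp only [ipV_sub] at i1 i2 i3 i4 i5 i6 i7
  have j4 : 0 ≤ σ / 2 * eNorm (M (lp - lb)) ^ 2 := by positivity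
  have j2 : 0 ≤ σ / 2 * e ^ 2 := by positivity
  have k1 : σ / 2 * e ^ 2 ≤ r * x := by nlinarith [sq_nonneg r]
  have k2 : -(ipV gdstar lp - ipV gdstar lb) ≤ r * x := by nlinarith [sq_nonneg r]
  have k3 : |ipV gdstar (lam - lb)| ≤ r * x + N * r := by
    rw [ipV_sub, abs_of_nonpos i7]
    linarith
  -- Hoffman
  obtain ⟨v', hv1, hv2, hv3⟩ := hCb (lam - lb)
  have hsD : lam - v' ∈ Dpq p q := by
    intro i hi
    have a1 := hlam i hi
    have a2 := hbD i hi
    have a3 := (hv2 i).2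
    have a4 : max ((lam - lb) i) 0 ≤ lam i := max_le (by simp; exact a2) a1
    simp only [Pi.sub_apply] at a3 a4 ⊢
    linarith
  rw [hA, hA, Prod.mk.injEq] at hv1
  have hsL : lam - v' ∈ Lstar := by
    refine hchar lb hbL _ hsD ?_ ?_
    · rw [map_sub, hv1.1, map_sub]; abel
    · rw [ipV_sub, hv1.2, ipV_sub]; ring
  have hk := hbmin _ hsL
  have q1 : wNorm W (lb - lam) = x := by rw [← neg_sub lam lb, wNorm_neg']
  have q2 : wNorm W (lam - v' - lam) = wNorm W v' := by
    rw [← wNorm_neg' W v']; congr 1; abel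
  rw [q1, q2] at hk
  have q3 : ‖A (lam - lb)‖ ≤ e + (r * x + N * r) := by
    rw [hA, Prod.norm_mk]
    have b1 : ‖M (lam - lb)‖ ≤ e := by
      rw [he, ← neg_sub lam lb, map_neg, ← norm_neg]
      exact abs_le_eNorm _
    have b2 : 0 ≤ r * x + N * r := by positivity
    apply max_le
    · linarith
    · rw [Real.norm_eq_abs]; linarith
  have q4 : x ≤ θ * (e + (r * x + N * r)) := by
    calc x ≤ C' * ‖v'‖ := hk.trans (hCb' _)
      _ ≤ C' * (C * ‖A (lam - lb)‖) := mul_le_mul_of_nonneg_left hv3 hC'.le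
      _ ≤ C' * (C * (e + (r * x + N * r))) := by gcongr
      _ = _ := by rw [hθ]; ring
  -- absorb the square root term
  have q5 : θ * e ≤ x / 2 + θ ^ 2 * r / σ := by
    have c1 : (θ * e) ^ 2 ≤ (x / 2 + θ ^ 2 * r / σ) ^ 2 := by
      have c2 : e ^ 2 ≤ 2 * (r * x) / σ := by
        rw [le_div_iff₀ hσ]; linarith
      have c3 : (θ * e) ^ 2 ≤ θ ^ 2 * (2 * (r * x) / σ) := by
        rw [mul_pow]; exact mul_le_mul_of_nonneg_left c2 (sq_nonneg _)
      have c4 : θ ^ 2 * (2 * (r * x) / σ) = 4 * (x / 2) * (θ ^ 2 * r / σ) := by ring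
      linarith [sq_nonneg (x / 2 - θ ^ 2 * r / σ), add_sq (x / 2) (θ ^ 2 * r / σ), sub_sq (x / 2) (θ ^ 2 * r / σ)]
    exact (le_abs_self _).trans (abs_le_of_sq_le_sq c1 (by positivity))
  have q6 : x ≤ (2 * (θ ^ 2 / σ) + 2 * θ * (x + N)) * r := by
    have : θ ^ 2 * r / σ = θ ^ 2 / σ * r := by ring
    rw [this] at q5
    nlinarith
  refine q6.trans (mul_le_mul_of_nonneg_right ?_ hr0)
  have s1 : 4 / σ * (θ ^ 2 + σ) = 4 * (θ ^ 2 / σ) + 4 := by field_simp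
  have s2 : 0 ≤ θ ^ 2 / σ := by positivity
  have s3 : 2 * θ * (x + N) ≤ 2 + θ ^ 2 * (x ^ 2 + N ^ 2) := by
    nlinarith [sq_nonneg (θ * x - 1), sq_nonneg (θ * N - 1)]
  have s4 : x ^ 2 ≤ T ^ 2 := pow_le_pow_left₀ hx0 hxT 2
  have s5 : θ ^ 2 * (x ^ 2 + N ^ 2) ≤ θ ^ 2 * (T ^ 2 + N ^ 2) := by gcongr
  have s6 : 0 ≤ θ ^ 2 * (T ^ 2 + N ^ 2) := by positivity
  have s7 : 0 ≤ 6 * (θ ^ 2 + σ) / σ := by positivity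
  have s8 : 24 * (θ ^ 2 * (T ^ 2 + N ^ 2)) ≤
      12 * θ ^ 2 * (2 * T ^ 2 + 2 * N ^ 2) * (1 + 6 * (θ ^ 2 + σ) / σ) := by
    nlinarith [mul_nonneg s6 s7]
  rw [s1]
  linarith
end
end

section
/- For the dual gradient iterates λ^{k+1} = [λ^k + W⁻¹∇d(λ^k)]_D^W started from any λ⁰ ∈ D, with z^k = argmin_{z∈ℝⁿ} L(z, λ^k), the primal infeasibility converges linearly: for every k ≥ 2, ‖[G z^k − g]_D‖_{W⁻¹} ≤ ρ^{(k−2)/2} · R(λ⁰), where [v]_D denotes the Euclidean projection of v onto D (first p coordinates unchanged, positive parts of the last q coordinates), ρ = 4(1+κ̄)/(1+4(1+κ̄)), and R(λ⁰) = min_{λ* ∈ Λ*} ‖λ* − λ⁰‖_W. -/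
noncomputable section
open Finset

/-- linear convergence of primal infeasibility in the last primal iterate:
for `k ≥ 2`, `‖[G z^k − g]_D‖_{W⁻¹} ≤ ρ^{(k−2)/2} R(λ⁰)`. -/
theorem primal_infeasibility_linear
    (n p q : ℕ) (σf : ℝ) (hσf : 0 < σf)
    (f : (Fin n → ℝ) → ℝ)
    (hconv : ConvexOn ℝ Set.univ (fun z => f z - σf / 2 * (eNorm z) ^ 2))
    (hfdiff : Differentiable ℝ f)
    (G : Matrix (Fin (p + q)) (Fin n) ℝ) (g : Fin (p + q) → ℝ)
    (Lag : (Fin n → ℝ) → (Fin (p + q) → ℝ) → ℝ)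
    (hLag : ∀ z lam, Lag z lam = f z + ipV lam (G.mulVec z - g))
    (zmin : (Fin (p + q) → ℝ) → (Fin n → ℝ))
    (hzmin : ∀ lam z, Lag (zmin lam) lam ≤ Lag z lam)
    (d : (Fin (p + q) → ℝ) → ℝ) (hd : ∀ lam, d lam = Lag (zmin lam) lam)
    (gradD : (Fin (p + q) → ℝ) → (Fin (p + q) → ℝ))
    (hgradD : ∀ lam, gradD lam = G.mulVec (zmin lam) - g)
    (W : Fin (p + q) → ℝ) (hW : ∀ i, 0 < W i)
    (hdescent : ∀ lam ∈ Dpq p q, ∀ mu ∈ Dpq p q,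
      d lam ≥ d mu + ipV (gradD mu) (lam - mu) - 1 / 2 * (wNorm W (lam - mu)) ^ 2)
    (fstar : ℝ) (Lstar : Set (Fin (p + q) → ℝ))
    (hLstar : ∀ l, l ∈ Lstar ↔ (l ∈ Dpq p q ∧ ∀ mu ∈ Dpq p q, d mu ≤ d l))
    (hLne : Lstar.Nonempty)
    (hval : ∀ l ∈ Lstar, d l = fstar)
    (hprimal : IsGLB (f '' {z | ∀ i : Fin (p + q),
      ((i : ℕ) < p → (G.mulVec z - g) i = 0) ∧ (p ≤ (i : ℕ) → (G.mulVec z - g) i ≤ 0)}) fstar)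
    (projLs : (Fin (p + q) → ℝ) → (Fin (p + q) → ℝ))
    (hprojLs : ∀ x, projLs x ∈ Lstar ∧ ∀ s ∈ Lstar, wNorm W (projLs x - x) ≤ wNorm W (s - x))
    (kb : ℝ) (hkb : 0 < kb)
    (heb : ∀ lam ∈ Dpq p q, wNorm W (lam - projLs lam) ≤
      kb * wNorm W (projDpq p q (lam + fun i => (W i)⁻¹ * gradD lam i) - lam))
    (lam : ℕ → Fin (p + q) → ℝ) (hlam0 : lam 0 ∈ Dpq p q)
    (hiter : ∀ k, lam (k + 1) = projDpq p q (lam k + fun i => (W i)⁻¹ * gradD (lam k) i))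
    (ρ R : ℝ) (hρ : ρ = 4 * (1 + kb) / (1 + 4 * (1 + kb)))
    (hR : R = sInf ((fun l => wNorm W (l - lam 0)) '' Lstar)) :
    ∀ k : ℕ, 2 ≤ k →
      wNorm (fun i => (W i)⁻¹) (projDpq p q (G.mulVec (zmin (lam k)) - g)) ≤
        Real.sqrt (ρ ^ (k - 2)) * R := by
  have hQ : ∀ x : Fin (p + q) → ℝ, wNorm W x ^ 2 = ∑ i, W i * (x i) ^ 2 := by
    intro x
    exact Real.sq_sqrt (Finset.sum_nonneg fun i _ => mul_nonneg (hW i).le (sq_nonneg _))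
  have hwn : ∀ x : Fin (p + q) → ℝ, 0 ≤ wNorm W x := fun x => Real.sqrt_nonneg _
  have hD : ∀ k, lam k ∈ Dpq p q := by
    intro k
    cases k with
    | zero => exact hlam0
    | succ k =>
      intro i hi
      rw [hiter]
      simp [projDpq, not_lt.mpr hi]
  -- concavity
  have hconc : ∀ l mu, d mu ≤ d l + ipV (gradD l) (mu - l) := by
    intro l mu
    have h1 : d mu ≤ Lag (zmin l) mu := by rw [hd]; exact hzmin _ _
    rw [hLag] at h1
    rw [hd l, hLag, hgradD]
    refine h1.trans (le_of_eq ?_)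
    unfold ipV
    rw [add_assoc, ← Finset.sum_add_distrib]
    congr 1
    apply Finset.sum_congr rfl
    intro i _
    simp only [Pi.sub_apply]
    ring
  have key : ∀ k, ∀ mu ∈ Dpq p q, d mu - d (lam (k + 1)) ≤
      ∑ i, W i * ((lam (k + 1) - lam k) i * (mu - lam k) i)
        - 1 / 2 * ∑ i, W i * ((lam (k + 1) - lam k) i) ^ 2 := by
    intro k mu hmu
    have h1 := hconc (lam k) mu
    have h2 := hdescent _ (hD (k + 1)) _ (hD k)
    rw [hQ] at h2
    have h3 : ipV (gradD (lam k)) (mu - lam k) - ipV (gradD (lam k)) (lam (k + 1) - lam k) ≤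
        ∑ i, W i * ((lam (k + 1) - lam k) i * (mu - lam k) i)
        - ∑ i, W i * ((lam (k + 1) - lam k) i) ^ 2 := by
      unfold ipV
      rw [← Finset.sum_sub_distrib, ← Finset.sum_sub_distrib]
      apply Finset.sum_le_sum
      intro i _
      have hi := congrFun (hiter k) i
      simp only [projDpq, Pi.add_apply] at hi
      simp only [Pi.sub_apply]
      have hw := hW i
      have hG : gradD (lam k) i = W i * ((W i)⁻¹ * gradD (lam k) i) := by
        field_simp
      rw [hG]
      generalize (W i)⁻¹ * gradD (lam k) i = u at hi ⊢
      have : (lam k i + u - lam (k + 1) i) * (mu i - lam (k + 1) i) ≤ 0 := by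
        split_ifs at hi with hp
        · rw [hi]; simp
        · have hm := hmu i (not_lt.mp hp)
          rcases le_total (lam k i + u) 0 with h | h
          · rw [max_eq_right h] at hi
            rw [hi]; nlinarith
          · rw [max_eq_left h] at hi
            rw [hi]; simp
      nlinarith [mul_le_mul_of_nonneg_left this hw.le]
    linarith
  have asc : ∀ k, 1 / 2 * ∑ i, W i * ((lam (k + 1) - lam k) i) ^ 2 ≤
      d (lam (k + 1)) - d (lam k) := by
    intro k
    have := key k _ (hD k)
    simp only [sub_self, Pi.zero_apply, mul_zero, Finset.sum_const_zero] at this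
    linarith
  have hmem : ∀ l ∈ Lstar, l ∈ Dpq p q := fun l hl => ((hLstar l).1 hl).1
  have hle : ∀ k, d (lam k) ≤ fstar := by
    intro k
    obtain ⟨l, hl⟩ := hLne
    rw [← hval l hl]
    exact ((hLstar l).1 hl).2 _ (hD k)
  have hρ0 : 0 ≤ ρ := by rw [hρ]; positivity
  have hρ1 : ρ ≤ 1 := by
    rw [hρ, div_le_one (by positivity)]; linarith
  have hcontr : ∀ k, fstar - d (lam (k + 1)) ≤ ρ * (fstar - d (lam k)) := by
    intro k
    have hp := (hprojLs (lam k)).1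
    have h1 := key k _ (hmem _ hp)
    rw [hval _ hp] at h1
    have h2 := heb _ (hD k)
    rw [← hiter k] at h2
    have h3 := pow_le_pow_left₀ (hwn _) h2 2
    rw [mul_pow, hQ, hQ] at h3
    have h4 : ∑ i, W i * ((lam (k + 1) - lam k) i * (projLs (lam k) - lam k) i) ≤
        kb / 2 * ∑ i, W i * ((lam (k + 1) - lam k) i) ^ 2 +
        1 / (2 * kb) * ∑ i, W i * ((lam k - projLs (lam k)) i) ^ 2 := by
      rw [Finset.mul_sum, Finset.mul_sum, ← Finset.sum_add_distrib]
      apply Finset.sum_le_sum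
      intro i _
      simp only [Pi.sub_apply]
      generalize lam (k + 1) i - lam k i = a
      rw [← neg_sub (lam k i)]
      generalize lam k i - projLs (lam k) i = b
      have hw := hW i
      have : 0 ≤ W i * (1 / (2 * kb)) * (kb * a + b) ^ 2 := by positivity
      have e : W i * (1 / (2 * kb)) * (kb * a + b) ^ 2 =
        kb / 2 * (W i * a ^ 2) + 1 / (2 * kb) * (W i * b ^ 2) - W i * (a * -b) := by
        field_simp
        ring
      linarith
    have h5 := asc k
    set S := ∑ i, W i * ((lam (k + 1) - lam k) i) ^ 2 with hS
    have hS0 : 0 ≤ S := Finset.sum_nonneg fun i _ => mul_nonneg (hW i).le (sq_nonneg _)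
    have h6 : 1 / (2 * kb) * ∑ i, W i * ((lam k - projLs (lam k)) i) ^ 2 ≤ kb / 2 * S := by
      calc _ ≤ 1 / (2 * kb) * (kb ^ 2 * S) := by gcongr
        _ = kb / 2 * S := by field_simp
    have h7 : fstar - d (lam (k + 1)) ≤ kb * S := by linarith
    have h8 : kb * S ≤ 2 * kb * (d (lam (k + 1)) - d (lam k)) := by nlinarith
    rw [hρ, div_mul_eq_mul_div, le_div_iff₀ (by positivity)]
    nlinarith
  have hRp : wNorm W (projLs (lam 0) - lam 0) ≤ R := by
    rw [hR]
    apply le_csInf (hLne.image _)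
    rintro _ ⟨l, hl, rfl⟩
    exact (hprojLs (lam 0)).2 l hl
  have hR0 : 0 ≤ R := (hwn _).trans hRp
  have h1 : fstar - d (lam 1) ≤ 1 / 2 * R ^ 2 := by
    have hp := (hprojLs (lam 0)).1
    have h1 := key 0 _ (hmem _ hp)
    rw [hval _ hp] at h1
    have h3 := pow_le_pow_left₀ (hwn _) hRp 2
    rw [hQ] at h3
    have h4 : ∑ i, W i * ((lam (0 + 1) - lam 0) i * (projLs (lam 0) - lam 0) i) ≤
        1 / 2 * ∑ i, W i * ((lam (0 + 1) - lam 0) i) ^ 2 +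
        1 / 2 * ∑ i, W i * ((projLs (lam 0) - lam 0) i) ^ 2 := by
      rw [Finset.mul_sum, Finset.mul_sum, ← Finset.sum_add_distrib]
      apply Finset.sum_le_sum
      intro i _
      have := mul_nonneg (hW i).le
        (sq_nonneg ((lam (0 + 1) - lam 0) i - (projLs (lam 0) - lam 0) i))
      nlinarith
    have e : d (lam (0 + 1)) = d (lam 1) := rfl
    linarith
  have hlin : ∀ k, fstar - d (lam (k + 1)) ≤ ρ ^ k * (1 / 2 * R ^ 2) := by
    intro k
    induction k with
    | zero => simpa using h1
    | succ k ih =>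
      calc _ ≤ ρ * (fstar - d (lam (k + 1))) := hcontr _
        _ ≤ ρ * (ρ ^ k * (1 / 2 * R ^ 2)) := by gcongr
        _ = _ := by ring
  intro k hk
  obtain ⟨j, rfl⟩ := Nat.exists_eq_add_of_le' hk
  rw [Nat.add_sub_cancel, ← hgradD]
  have hinf : ∑ i, (W i)⁻¹ * (projDpq p q (gradD (lam (j + 2))) i) ^ 2 ≤
      ∑ i, W i * ((lam (j + 2 + 1) - lam (j + 2)) i) ^ 2 := by
    apply Finset.sum_le_sum
    intro i _
    have hi := congrFun (hiter (j + 2)) i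
    have hw := hW i
    simp only [projDpq, Pi.add_apply] at hi
    simp only [Pi.sub_apply, projDpq]
    have e : ∀ v : ℝ, (W i)⁻¹ * v ^ 2 = W i * ((W i)⁻¹ * v) ^ 2 := by
      intro v; field_simp
    rw [hi]
    split_ifs with hp
    · rw [e, add_sub_cancel_left]
    · have hl := hD (j + 2) i (not_lt.mp hp)
      rcases le_total (gradD (lam (j + 2)) i) 0 with h | h
      · rw [max_eq_right h]
        have : 0 ≤ W i * (max (lam (j + 2) i + (W i)⁻¹ * gradD (lam (j + 2)) i) 0
          - lam (j + 2) i) ^ 2 := by positivity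
        simpa using this
      · rw [max_eq_left h, max_eq_left (by positivity), e, add_sub_cancel_left]
  have hfin : ∑ i, (W i)⁻¹ * (projDpq p q (gradD (lam (j + 2))) i) ^ 2 ≤ ρ ^ j * R ^ 2 := by
    have a1 := asc (j + 2)
    have a2 := hle (j + 2 + 1)
    have a3 := hlin (j + 1)
    have e : d (lam (j + 1 + 1)) = d (lam (j + 2)) := rfl
    have a4 : ρ ^ (j + 1) * (1 / 2 * R ^ 2) ≤ ρ ^ j * (1 / 2 * R ^ 2) := by
      apply mul_le_mul_of_nonneg_right _ (by positivity)
      exact pow_le_pow_of_le_one hρ0 hρ1 (Nat.le_succ j)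
    linarith
  unfold wNorm
  refine (Real.sqrt_le_sqrt hfin).trans (le_of_eq ?_)
  rw [Real.sqrt_mul (pow_nonneg hρ0 _), Real.sqrt_sq hR0]
end
end

section
/- (Distributed descent lemma) Let d₁, …, d_M : ℝ^m → ℝ be differentiable functions such that each dᵢ has Lᵢ-Lipschitz gradient (Lᵢ > 0) and dᵢ depends only on the coordinates indexed by a set Sᵢ ⊆ {1,…,m}, i.e. dᵢ(λ) = dᵢ(λ') whenever λⱼ = λ'ⱼ for all j ∈ Sᵢ. Assume every j ∈ {1,…,m} belongs to at least one Sᵢ. Let g ∈ ℝ^m, d(λ) = Σ_{i=1}^M dᵢ(λ) − ⟨g, λ⟩, and let W be the diagonal matrix with entries W_{jj} = Σ_{i : j ∈ Sᵢ} Lᵢ. Then for all λ, λ̄ ∈ ℝ^m: d(λ) ≥ d(λ̄) + ⟨∇d(λ̄), λ − λ̄⟩ − (1/2)‖λ − λ̄‖²_W. -/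
noncomputable section
open Finset

theorem aux_hasDeriv {m : ℕ} (f : (Fin m → ℝ) → ℝ) (hf : Differentiable ℝ f) (x v : Fin m → ℝ)
    (t : ℝ) : HasDerivAt (fun t : ℝ => f (x + t • v)) (fderiv ℝ f (x + t • v) v) t := by
  have h1 : HasDerivAt (fun t : ℝ => x + t • v) v t := by
    simpa using ((hasDerivAt_id t).smul_const v).const_add x
  exact (hf (x + t • v)).hasFDerivAt.comp_hasDerivAt t h1

theorem aux_cs {m : ℕ} (x y : Fin m → ℝ) : -(eNorm x * eNorm y) ≤ ipV x y := by
  have h := Finset.sum_mul_sq_le_sq_mul_sq Finset.univ x y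
  have : |ipV x y| ≤ eNorm x * eNorm y := by
    unfold eNorm ipV
    rw [← Real.sqrt_mul (by positivity)]
    exact Real.abs_le_sqrt h
  exact (abs_le.mp this).1

theorem aux_descent {m : ℕ} (f : (Fin m → ℝ) → ℝ) (G : (Fin m → ℝ) → (Fin m → ℝ)) (L : ℝ)
    (hf : Differentiable ℝ f) (hG : ∀ x v, fderiv ℝ f x v = ipV (G x) v)
    (hLip : ∀ x y, eNorm (G x - G y) ≤ L * eNorm (x - y)) (x v : Fin m → ℝ) :
    f x + ipV (G x) v - 1 / 2 * (L * ∑ j, v j ^ 2) ≤ f (x + v) := by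
  set N := ∑ j, v j ^ 2 with hN
  have hN0 : 0 ≤ N := by positivity
  have hd : ∀ t : ℝ, HasDerivAt
      (fun t : ℝ => f (x + t • v) - t * ipV (G x) v + t ^ 2 * (1 / 2 * (L * N)))
      (ipV (G (x + t • v)) v - ipV (G x) v + 2 * t * (1 / 2 * (L * N))) t := by
    intro t
    have h1 := aux_hasDeriv f hf x v t
    rw [hG] at h1
    have h2 := (hasDerivAt_id t).mul_const (ipV (G x) v)
    have h3 := (hasDerivAt_pow 2 t).mul_const (1 / 2 * (L * N))
    refine ((h1.sub h2).add h3).congr_deriv ?_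
    simp
  have hmono := monotoneOn_of_deriv_nonneg (convex_Icc (0:ℝ) 1)
    (fun t _ => (hd t).continuousAt.continuousWithinAt)
    (fun t _ => (hd t).differentiableAt.differentiableWithinAt)
    (by
      intro t ht
      rw [interior_Icc] at ht
      rw [(hd t).deriv]
      have ht0 : 0 ≤ t := ht.1.le
      have e1 : ipV (G (x + t • v)) v - ipV (G x) v = ipV (G (x + t • v) - G x) v := by
        simp [ipV, sub_mul]
      have e2 := aux_cs (G (x + t • v) - G x) v
      have e3 := hLip (x + t • v) x
      have e4 : eNorm (x + t • v - x) = t * eNorm v := by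
        simp only [eNorm, add_sub_cancel_left, Pi.smul_apply, smul_eq_mul, mul_pow]
        rw [← Finset.mul_sum, Real.sqrt_mul (by positivity), Real.sqrt_sq ht0]
      have e5 : eNorm v * eNorm v = N := Real.mul_self_sqrt hN0
      have e6 : 0 ≤ eNorm v := Real.sqrt_nonneg _
      rw [e4] at e3
      have e7 := mul_le_mul_of_nonneg_right e3 e6
      have e8 : L * (t * eNorm v) * eNorm v = L * t * N := by rw [← e5]; ring
      rw [e1]
      linarith)
  have := hmono (by simp : (0:ℝ) ∈ Set.Icc 0 1) (by simp : (1:ℝ) ∈ Set.Icc 0 1) zero_le_one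
  simp at this
  linarith

theorem aux_local {m : ℕ} (f : (Fin m → ℝ) → ℝ) (G : (Fin m → ℝ) → (Fin m → ℝ)) (L : ℝ)
    (hf : Differentiable ℝ f) (hG : ∀ x v, fderiv ℝ f x v = ipV (G x) v)
    (hLip : ∀ x y, eNorm (G x - G y) ≤ L * eNorm (x - y)) (S : Finset (Fin m))
    (hdep : ∀ x y : Fin m → ℝ, (∀ j ∈ S, x j = y j) → f x = f y) (y x : Fin m → ℝ) :
    f x + ipV (G x) (y - x) - 1 / 2 * (∑ j, (if j ∈ S then L else 0) * (y - x) j ^ 2) ≤ f y := by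
  set v : Fin m → ℝ := fun j => if j ∈ S then (y - x) j else 0 with hv
  have h := aux_descent f G L hf hG hLip x v
  have h1 : f (x + v) = f y := hdep _ _ (fun j hj => by simp [hv, hj])
  have h2 : fderiv ℝ f x (y - x - v) = 0 := by
    have a := aux_hasDeriv f hf x (y - x - v) 0
    have b : (fun t : ℝ => f (x + t • (y - x - v))) = fun _ => f x := by
      funext t
      exact hdep _ _ (fun j hj => by simp [hv, hj])
    rw [b] at a
    simpa using a.unique (hasDerivAt_const 0 (f x))
  rw [map_sub, hG, hG] at h2
  have h3 : L * ∑ j, v j ^ 2 = ∑ j, (if j ∈ S then L else 0) * (y - x) j ^ 2 := by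
    rw [Finset.mul_sum]
    refine Finset.sum_congr rfl fun j _ => ?_
    by_cases hj : j ∈ S <;> simp [hv, hj]
  rw [h1, h3] at h
  linarith

/-- distributed descent lemma: if each `dᵢ` has `Lᵢ`-Lipschitz gradient and
depends only on the coordinates in `Sᵢ`, and every coordinate is covered by some `Sᵢ`, then
`d = Σᵢ dᵢ − ⟨g,·⟩` satisfies the `W`-descent inequality with `W_{jj} = Σ_{i : j ∈ Sᵢ} Lᵢ`. -/
theorem distributed_descent_lemma
    (m M : ℕ) (di : Fin M → (Fin m → ℝ) → ℝ)
    (gdi : Fin M → (Fin m → ℝ) → (Fin m → ℝ))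
    (L : Fin M → ℝ) (hL : ∀ i, 0 < L i)
    (hdiff : ∀ i, Differentiable ℝ (di i))
    (hgrad : ∀ i x v, fderiv ℝ (di i) x v = ipV (gdi i x) v)
    (hLip : ∀ i x y, eNorm (gdi i x - gdi i y) ≤ L i * eNorm (x - y))
    (S : Fin M → Finset (Fin m))
    (hdep : ∀ i, ∀ x y : Fin m → ℝ, (∀ j ∈ S i, x j = y j) → di i x = di i y)
    (hcov : ∀ j : Fin m, ∃ i, j ∈ S i)
    (g : Fin m → ℝ)
    (d : (Fin m → ℝ) → ℝ) (hd : ∀ lam, d lam = (∑ i, di i lam) - ipV g lam)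
    (W : Fin m → ℝ)
    (hWdef : ∀ j, W j = ∑ i ∈ Finset.univ.filter (fun i => j ∈ S i), L i) :
    ∀ lam lamb : Fin m → ℝ,
      d lam ≥ d lamb + ipV ((∑ i, gdi i lamb) - g) (lam - lamb)
        - 1 / 2 * (wNorm W (lam - lamb)) ^ 2 := by
  intro lam lamb
  have hs := Finset.sum_le_sum (s := Finset.univ) fun i _ =>
    aux_local (di i) (gdi i) (L i) (hdiff i) (hgrad i) (hLip i) (S i) (hdep i) lam lamb
  rw [Finset.sum_sub_distrib, Finset.sum_add_distrib, ← Finset.mul_sum] at hs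
  have hW : ∀ j, W j = ∑ i, if j ∈ S i then L i else 0 := fun j => by
    rw [hWdef, Finset.sum_filter]
  have hW0 : ∀ j, 0 ≤ W j := fun j => by
    rw [hWdef]; exact Finset.sum_nonneg fun i _ => (hL i).le
  have e1 : wNorm W (lam - lamb) ^ 2
      = ∑ i, ∑ j, (if j ∈ S i then L i else 0) * (lam - lamb) j ^ 2 := by
    unfold wNorm
    rw [Real.sq_sqrt (Finset.sum_nonneg fun j _ => mul_nonneg (hW0 j) (sq_nonneg _)),
      Finset.sum_comm]
    refine Finset.sum_congr rfl fun j _ => ?_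
    rw [hW, Finset.sum_mul]
  have e2 : ipV ((∑ i, gdi i lamb) - g) (lam - lamb)
      = ∑ i, ipV (gdi i lamb) (lam - lamb) - (ipV g lam - ipV g lamb) := by
    unfold ipV
    rw [Finset.sum_comm, ← Finset.sum_sub_distrib, ← Finset.sum_sub_distrib]
    refine Finset.sum_congr rfl fun j _ => ?_
    rw [← Finset.sum_mul]
    simp only [Pi.sub_apply, Finset.sum_apply]
    ring
  rw [hd, hd, e1, e2]
  linarith
end
end

section
/- Let ψ : ℝⁿ → ℝ be σ-strongly convex and differentiable, G an m×n real matrix, g ∈ ℝ^m, and D ⊆ ℝ^m a convex set. Define d(λ) = −ψ(−Gᵀλ) − ⟨g, λ⟩ and let Λ* be the set of maximizers of d over D, assumed nonempty. Then there exists a unique y* ∈ ℝⁿ such that Gᵀλ* = y* for every λ* ∈ Λ*. Moreover, ∇d(λ) = G∇ψ(−y*) − g for every λ in the set Λ = {λ ∈ D : Gᵀλ = y*}; in particular ∇d is constant on Λ. -/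
noncomputable section
open Finset

/-- Lemma: uniqueness of `Gᵀλ*` over the dual optimal set and constancy of
the dual gradient on `Λ = {λ ∈ D : Gᵀλ = y*}`. -/
theorem dual_gradient_constant_on_optimal_face
    (n m : ℕ) (σ : ℝ) (hσ : 0 < σ)
    (ψ : (Fin n → ℝ) → ℝ) (gψ : (Fin n → ℝ) → (Fin n → ℝ))
    (hconv : ConvexOn ℝ Set.univ (fun x => ψ x - σ / 2 * (eNorm x) ^ 2))
    (hdiff : Differentiable ℝ ψ)
    (hgrad : ∀ x v, fderiv ℝ ψ x v = ipV (gψ x) v)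
    (G : Matrix (Fin m) (Fin n) ℝ) (g : Fin m → ℝ)
    (D : Set (Fin m → ℝ)) (hDconv : Convex ℝ D)
    (d : (Fin m → ℝ) → ℝ)
    (hd : ∀ lam, d lam = -ψ (-(G.transpose.mulVec lam)) - ipV g lam)
    (Lstar : Set (Fin m → ℝ))
    (hLstar : ∀ l, l ∈ Lstar ↔ (l ∈ D ∧ ∀ mu ∈ D, d mu ≤ d l))
    (hLne : Lstar.Nonempty) :
    ∃ ystar : Fin n → ℝ,
      (∀ l ∈ Lstar, G.transpose.mulVec l = ystar) ∧
      (∀ y : Fin n → ℝ, (∀ l ∈ Lstar, G.transpose.mulVec l = y) → y = ystar) ∧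
      (∀ lam ∈ D, G.transpose.mulVec lam = ystar →
        ∀ v, fderiv ℝ d lam v = ipV (G.mulVec (gψ (-ystar)) - g) v) := by
  have key : ∀ l ∈ Lstar, ∀ k ∈ Lstar, G.transpose.mulVec l = G.transpose.mulVec k := by
    intro l hl k hk
    obtain ⟨hlD, hlm⟩ := (hLstar l).1 hl
    obtain ⟨hkD, hkm⟩ := (hLstar k).1 hk
    have heq : d l = d k := le_antisymm (hkm l hlD) (hlm k hkD)
    have hmid := hlm _ (hDconv hlD hkD (by norm_num : (0:ℝ) ≤ 1/2)
      (by norm_num : (0:ℝ) ≤ 1/2) (by norm_num))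
    have hc := hconv.2 (Set.mem_univ (-(G.transpose.mulVec l)))
      (Set.mem_univ (-(G.transpose.mulVec k))) (by norm_num : (0:ℝ) ≤ 1/2)
      (by norm_num : (0:ℝ) ≤ 1/2) (by norm_num)
    have hsq : ∀ x : Fin n → ℝ, eNorm x ^ 2 = ∑ i, x i ^ 2 := fun x =>
      Real.sq_sqrt (Finset.sum_nonneg fun i _ => sq_nonneg _)
    have hG : -(G.transpose.mulVec ((1/2:ℝ) • l + (1/2:ℝ) • k)) =
        (1/2:ℝ) • (-(G.transpose.mulVec l)) + (1/2:ℝ) • (-(G.transpose.mulVec k)) := by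
      rw [Matrix.mulVec_add, Matrix.mulVec_smul, Matrix.mulVec_smul, smul_neg, smul_neg, neg_add]
    have hip : ipV g ((1/2:ℝ) • l + (1/2:ℝ) • k) = 1/2 * ipV g l + 1/2 * ipV g k := by
      simp only [ipV, Finset.mul_sum, ← Finset.sum_add_distrib]
      refine Finset.sum_congr rfl fun i _ => ?_
      simp only [Pi.add_apply, Pi.smul_apply, smul_eq_mul]
      ring
    rw [hd, hd l, hG, hip] at hmid
    rw [hd, hd] at heq
    simp only [hsq, smul_eq_mul] at hc
    generalize G.transpose.mulVec l = a at *
    generalize G.transpose.mulVec k = b at *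
    have hpar : ∑ i, ((1/2:ℝ) • (-a) + (1/2:ℝ) • (-b)) i ^ 2 =
        1/2 * ∑ i, (-a) i ^ 2 + 1/2 * ∑ i, (-b) i ^ 2 - 1/4 * ∑ i, (a i - b i) ^ 2 := by
      simp only [Finset.mul_sum, ← Finset.sum_add_distrib, ← Finset.sum_sub_distrib]
      refine Finset.sum_congr rfl fun i _ => ?_
      simp only [Pi.add_apply, Pi.smul_apply, Pi.neg_apply, smul_eq_mul]
      ring
    rw [hpar] at hc
    have h0 : σ * ∑ i, (a i - b i) ^ 2 ≤ 0 := by linarith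
    have h1 : ∑ i, (a i - b i) ^ 2 ≤ 0 := nonpos_of_mul_nonpos_right h0 hσ
    have h2 : ∑ i, (a i - b i) ^ 2 = 0 :=
      le_antisymm h1 (Finset.sum_nonneg fun i _ => sq_nonneg _)
    rw [Finset.sum_eq_zero_iff_of_nonneg (fun i _ => sq_nonneg _)] at h2
    funext i
    exact sub_eq_zero.1 (pow_eq_zero_iff (two_ne_zero) |>.1 (h2 i (Finset.mem_univ i)))
  obtain ⟨l0, hl0⟩ := hLne
  refine ⟨G.transpose.mulVec l0, fun l hl => key l hl l0 hl0, fun y hy => (hy l0 hl0).symm, ?_⟩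
  intro lam _ hlam v
  rw [← hlam]
  have hd' : d = fun lam => -ψ (-(G.transpose.mulVec lam)) - ipV g lam := funext hd
  let A : (Fin m → ℝ) →L[ℝ] (Fin n → ℝ) := LinearMap.toContinuousLinearMap G.transpose.mulVecLin
  let B : (Fin m → ℝ) →L[ℝ] ℝ := ∑ i, g i • ContinuousLinearMap.proj (R := ℝ) i
  have hA : ∀ x, A x = G.transpose.mulVec x := fun x => rfl
  have hB : ∀ x, B x = ipV g x := fun x => by simp [B, ipV]
  have hF : HasFDerivAt d (-((fderiv ℝ ψ (-(G.transpose.mulVec lam))).comp (-A)) - B) lam := by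
    have e : d = fun x => -ψ ((-A) x) - B x := by
      funext x
      rw [hd, hB, ContinuousLinearMap.neg_apply, hA]
    rw [e]
    have h1 : HasFDerivAt ψ (fderiv ℝ ψ (-(G.transpose.mulVec lam))) ((-A) lam) :=
      (hdiff _).hasFDerivAt
    exact (h1.comp lam (-A).hasFDerivAt).neg.sub B.hasFDerivAt
  rw [hF.fderiv]
  have e1 : (-((fderiv ℝ ψ (-(G.transpose.mulVec lam))).comp (-A)) - B) v =
      fderiv ℝ ψ (-(G.transpose.mulVec lam)) (G.transpose.mulVec v) - ipV g v := by
    simp [hB, hA]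
  rw [e1, hgrad]
  change gψ _ ⬝ᵥ G.transpose.mulVec v - g ⬝ᵥ v = (G.mulVec (gψ _) - g) ⬝ᵥ v
  rw [sub_dotProduct, Matrix.dotProduct_mulVec, Matrix.vecMul_transpose]
end
end

section
/- (Ascent property of the weighted projected gradient step) Let D ⊆ ℝ^m be a nonempty closed convex set, W an m×m symmetric positive definite matrix, and d : ℝ^m → ℝ differentiable satisfying the W-descent inequality on D: d(λ) ≥ d(μ) + ⟨∇d(μ), λ − μ⟩ − (1/2)‖λ − μ‖²_W for all λ, μ ∈ D. Then for every λ ∈ D, the point λ⁺ = [λ + W⁻¹∇d(λ)]_D^W satisfies d(λ⁺) ≥ d(λ) + (1/2)‖λ − λ⁺‖²_W. -/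
noncomputable section
open Finset

lemma mNorm_sq_aux {m : ℕ} (W : Matrix (Fin m) (Fin m) ℝ) (hWpd : W.PosDef) (x : Fin m → ℝ) :
    (mNorm W x) ^ 2 = x ⬝ᵥ W.mulVec x := by
  have h : 0 ≤ x ⬝ᵥ W.mulVec x := by
    simpa using hWpd.posSemidef.dotProduct_mulVec_nonneg x
  exact Real.sq_sqrt h

lemma symm_aux {m : ℕ} (W : Matrix (Fin m) (Fin m) ℝ) (hWsym : W.IsSymm) (x y : Fin m → ℝ) :
    x ⬝ᵥ W.mulVec y = y ⬝ᵥ W.mulVec x := by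
  rw [Matrix.dotProduct_mulVec, ← Matrix.mulVec_transpose, hWsym.eq, dotProduct_comm]

/-- ascent property of the weighted projected gradient step:
`d(λ⁺) ≥ d(λ) + (1/2)‖λ − λ⁺‖²_W` for `λ⁺ = [λ + W⁻¹∇d(λ)]_D^W`. -/
theorem projected_gradient_ascent
    (m : ℕ) (D : Set (Fin m → ℝ)) (hDne : D.Nonempty) (hDcl : IsClosed D) (hDconv : Convex ℝ D)
    (W : Matrix (Fin m) (Fin m) ℝ) (hWsym : W.IsSymm) (hWpd : W.PosDef)
    (d : (Fin m → ℝ) → ℝ) (gradD : (Fin m → ℝ) → (Fin m → ℝ))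
    (hdiff : Differentiable ℝ d)
    (hgrad : ∀ x v, fderiv ℝ d x v = ipV (gradD x) v)
    (hdescent : ∀ lam ∈ D, ∀ mu ∈ D,
      d lam ≥ d mu + ipV (gradD mu) (lam - mu) - 1 / 2 * (mNorm W (lam - mu)) ^ 2)
    (projD : (Fin m → ℝ) → (Fin m → ℝ))
    (hprojD : ∀ x, projD x ∈ D ∧ ∀ s ∈ D, mNorm W (projD x - x) ≤ mNorm W (s - x)) :
    ∀ lam ∈ D,
      d (projD (lam + W⁻¹.mulVec (gradD lam))) ≥
        d lam + 1 / 2 * (mNorm W (lam - projD (lam + W⁻¹.mulVec (gradD lam)))) ^ 2 := by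
  intro lam hlam
  set g := W⁻¹.mulVec (gradD lam) with hg
  obtain ⟨hpD, hmin⟩ := hprojD (lam + g)
  set p := projD (lam + g) with hp
  have hWg : W.mulVec g = gradD lam := by
    rw [hg, Matrix.mulVec_mulVec, Matrix.mul_nonsing_inv _ hWpd.det_pos.ne'.isUnit,
      Matrix.one_mulVec]
  have hd := hdescent p hpD lam hlam
  rw [mNorm_sq_aux W hWpd] at hd ⊢
  have hip : ipV (gradD lam) (p - lam) = - ((lam - p) ⬝ᵥ W.mulVec g) := by
    rw [hWg, dotProduct_comm, ← dotProduct_neg, neg_sub]; rfl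
  have hneg : p - lam = -(lam - p) := by abel
  rw [hip, hneg, Matrix.mulVec_neg, dotProduct_neg, neg_dotProduct, neg_neg] at hd
  set e := lam - p with he
  have key : ∀ t : ℝ, 0 < t → t ≤ 1 →
      0 ≤ 2 * (-(e ⬝ᵥ W.mulVec e) - e ⬝ᵥ W.mulVec g) + t * (e ⬝ᵥ W.mulVec e) := by
    intro t ht ht1
    have hs : p + t • e ∈ D := hDconv.add_smul_sub_mem hpD hlam ⟨ht.le, ht1⟩
    have h1 := hmin _ hs
    have h2 : (mNorm W (p - (lam + g))) ^ 2 ≤ (mNorm W (p + t • e - (lam + g))) ^ 2 :=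
      pow_le_pow_left₀ (Real.sqrt_nonneg _) h1 2
    rw [mNorm_sq_aux W hWpd, mNorm_sq_aux W hWpd] at h2
    have e1 : p - (lam + g) = -e + -g := by rw [he]; abel
    have e2 : p + t • e - (lam + g) = -e + -g + t • e := by rw [← e1]; abel
    rw [e1, e2] at h2
    simp only [Matrix.mulVec_add, Matrix.mulVec_neg, Matrix.mulVec_smul, dotProduct_add,
      add_dotProduct, neg_dotProduct, dotProduct_neg, smul_dotProduct, dotProduct_smul,
      smul_eq_mul, symm_aux W hWsym g e] at h2
    refine le_of_mul_le_mul_left ?_ ht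
    linarith
  have hQ : 0 ≤ -(e ⬝ᵥ W.mulVec e) - e ⬝ᵥ W.mulVec g := by
    have hQe : 0 ≤ e ⬝ᵥ W.mulVec e := by
      simpa using hWpd.posSemidef.dotProduct_mulVec_nonneg e
    by_contra hc
    push Not at hc
    set a := -(e ⬝ᵥ W.mulVec e) - e ⬝ᵥ W.mulVec g
    set q := e ⬝ᵥ W.mulVec e
    have hpos : 0 < q - a := by linarith
    have := key (-a / (q - a)) (div_pos (by linarith) hpos)
      ((div_le_one hpos).2 (by linarith))
    have h3 : -a / (q - a) * q ≤ -a := by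
      rw [div_mul_eq_mul_div, div_le_iff₀ hpos]
      nlinarith
    linarith
  linarith
end
end

section
/- Let D ⊆ ℝ^m be a nonempty closed convex set, W an m×m symmetric positive definite matrix, and d : ℝ^m → ℝ concave and differentiable, satisfying the W-descent inequality on D: d(λ) ≥ d(μ) + ⟨∇d(μ), λ − μ⟩ − (1/2)‖λ − μ‖²_W for all λ, μ ∈ D. Suppose d attains its maximum value f* over D on a nonempty set Λ* ⊆ D. Then for every λ⁰ ∈ D, the point λ¹ = [λ⁰ + W⁻¹∇d(λ⁰)]_D^W satisfies f* − d(λ¹) ≤ (1/2) · min_{λ* ∈ Λ*} ‖λ* − λ⁰‖²_W. -/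
noncomputable section
open Finset

lemma aux_q {m : ℕ} (W : Matrix (Fin m) (Fin m) ℝ) (hWpd : W.PosDef) (x : Fin m → ℝ) :
    (mNorm W x) ^ 2 = x ⬝ᵥ (W.mulVec x) := by
  have h : 0 ≤ ipV x (W.mulVec x) := by
    have := hWpd.posSemidef.dotProduct_mulVec_nonneg x
    simpa [ipV, dotProduct] using this
  unfold mNorm
  rw [Real.sq_sqrt h]
  rfl

lemma aux_expand {m : ℕ} (W : Matrix (Fin m) (Fin m) ℝ) (hWsym : W.IsSymm) (hWpd : W.PosDef)
    (g s l : Fin m → ℝ) :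
    (mNorm W (s - (l + W⁻¹.mulVec g))) ^ 2 = (mNorm W (s - l)) ^ 2 - 2 * ipV g (s - l)
      + (mNorm W (W⁻¹.mulVec g)) ^ 2 := by
  have hW : W.mulVec (W⁻¹.mulVec g) = g := by
    rw [Matrix.mulVec_mulVec, Matrix.mul_nonsing_inv _ ((Matrix.isUnit_iff_isUnit_det _).1 hWpd.isUnit),
      Matrix.one_mulVec]
  rw [aux_q W hWpd, aux_q W hWpd, aux_q W hWpd, ← sub_sub]
  set u := s - l
  have h2 : (W⁻¹.mulVec g) ⬝ᵥ (W.mulVec u) = g ⬝ᵥ u := by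
    rw [Matrix.dotProduct_mulVec, ← Matrix.mulVec_transpose, hWsym.eq, hW]
  have h3 : ipV g u = g ⬝ᵥ u := rfl
  rw [Matrix.mulVec_sub, hW, sub_dotProduct, dotProduct_sub, dotProduct_sub, h2, h3,
    dotProduct_comm u g]
  ring

lemma aux_conc {m : ℕ} (d : (Fin m → ℝ) → ℝ) (hconc : ConcaveOn ℝ Set.univ d)
    (hdiff : Differentiable ℝ d) (x y : Fin m → ℝ) :
    d y ≤ d x + fderiv ℝ d x (y - x) := by
  have hc : ConcaveOn ℝ Set.univ (d ∘ AffineMap.lineMap (k := ℝ) x y) := by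
    simpa using hconc.comp_affineMap (AffineMap.lineMap (k := ℝ) x y)
  have hd : HasDerivAt (d ∘ AffineMap.lineMap (k := ℝ) x y) (fderiv ℝ d x (y - x)) 0 := by
    have h1 : HasFDerivAt d (fderiv ℝ d x) (AffineMap.lineMap (k := ℝ) x y (0:ℝ)) := by
      simpa using (hdiff x).hasFDerivAt
    exact h1.comp_hasDerivAt 0 AffineMap.hasDerivAt_lineMap
  have := hc.slope_le_of_hasDerivAt (Set.mem_univ 0) (Set.mem_univ 1) one_pos hd
  simp [slope_def_field] at this
  rw [map_sub]
  linarith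

/-- one-step dual suboptimality bound:
`f* − d(λ¹) ≤ (1/2) min_{λ* ∈ Λ*} ‖λ* − λ⁰‖²_W` for `λ¹ = [λ⁰ + W⁻¹∇d(λ⁰)]_D^W`. -/
theorem first_iterate_suboptimality
    (m : ℕ) (D : Set (Fin m → ℝ)) (hDne : D.Nonempty) (hDcl : IsClosed D) (hDconv : Convex ℝ D)
    (W : Matrix (Fin m) (Fin m) ℝ) (hWsym : W.IsSymm) (hWpd : W.PosDef)
    (d : (Fin m → ℝ) → ℝ) (hconc : ConcaveOn ℝ Set.univ d)
    (gradD : (Fin m → ℝ) → (Fin m → ℝ))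
    (hdiff : Differentiable ℝ d)
    (hgrad : ∀ x v, fderiv ℝ d x v = ipV (gradD x) v)
    (hdescent : ∀ lam ∈ D, ∀ mu ∈ D,
      d lam ≥ d mu + ipV (gradD mu) (lam - mu) - 1 / 2 * (mNorm W (lam - mu)) ^ 2)
    (projD : (Fin m → ℝ) → (Fin m → ℝ))
    (hprojD : ∀ x, projD x ∈ D ∧ ∀ s ∈ D, mNorm W (projD x - x) ≤ mNorm W (s - x))
    (fstar : ℝ) (Lstar : Set (Fin m → ℝ)) (hLsub : Lstar ⊆ D) (hLne : Lstar.Nonempty)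
    (hval : ∀ l ∈ Lstar, d l = fstar) (hub : ∀ mu ∈ D, d mu ≤ fstar) :
    ∀ lam0 ∈ D,
      fstar - d (projD (lam0 + W⁻¹.mulVec (gradD lam0))) ≤
        1 / 2 * (sInf ((fun l => mNorm W (l - lam0)) '' Lstar)) ^ 2 := by
  intro lam0 h0
  set p := projD (lam0 + W⁻¹.mulVec (gradD lam0)) with hp
  obtain ⟨hpD, hpm⟩ := hprojD (lam0 + W⁻¹.mulVec (gradD lam0))
  rw [← hp] at hpD hpm
  have key : ∀ l ∈ Lstar, 2 * (fstar - d p) ≤ (mNorm W (l - lam0)) ^ 2 := by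
    intro l hl
    have h1 := hdescent p hpD lam0 h0
    have hn : 0 ≤ mNorm W (p - (lam0 + W⁻¹.mulVec (gradD lam0))) := Real.sqrt_nonneg _
    have h2 := pow_le_pow_left₀ hn (hpm l (hLsub hl)) 2
    rw [aux_expand W hWsym hWpd, aux_expand W hWsym hWpd] at h2
    have h3 := aux_conc d hconc hdiff lam0 l
    rw [hgrad, hval l hl] at h3
    linarith
  have h4 : Real.sqrt (2 * (fstar - d p)) ≤ sInf ((fun l => mNorm W (l - lam0)) '' Lstar) := by
    apply le_csInf (hLne.image _)
    rintro _ ⟨l, hl, rfl⟩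
    exact Real.sqrt_le_iff.2 ⟨Real.sqrt_nonneg _, key l hl⟩
  have h5 := pow_le_pow_left₀ (Real.sqrt_nonneg _) h4 2
  rw [Real.sq_sqrt (by linarith [hub p hpD])] at h5
  linarith
end
end

section
/- (One-step linear contraction of dual suboptimality) Let D ⊆ ℝ^m be a nonempty closed convex set, W an m×m symmetric positive definite matrix, and d : ℝ^m → ℝ concave and differentiable, satisfying the W-descent inequality on D: d(λ) ≥ d(μ) + ⟨∇d(μ), λ − μ⟩ − (1/2)‖λ − μ‖²_W for all λ, μ ∈ D. Suppose d attains its maximum value f* over D on a nonempty closed set Λ* ⊆ D, and that λ ∈ D satisfies the error bound ‖λ − [λ]_{Λ*}^W‖_W ≤ κ̄ · ‖∇⁺d(λ)‖_W with κ̄ > 0. Then the point λ⁺ = [λ + W⁻¹∇d(λ)]_D^W satisfies f* − d(λ⁺) ≤ [4(1+κ̄)/(1+4(1+κ̄))] · (f* − d(λ)). -/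
noncomputable section
open Finset

open scoped Matrix

lemma aux_grad {m : ℕ} (d : (Fin m → ℝ) → ℝ) (hconc : ConcaveOn ℝ Set.univ d)
    (hdiff : Differentiable ℝ d) (x z : Fin m → ℝ) : d z ≤ d x + fderiv ℝ d x (z - x) := by
  have hc : ConcaveOn ℝ Set.univ (fun t : ℝ => d (AffineMap.lineMap x z t)) := by
    exact hconc.comp_affineMap (AffineMap.lineMap x z)
  have hd : HasDerivAt (fun t : ℝ => d (AffineMap.lineMap x z t)) (fderiv ℝ d x (z - x)) 0 := by
    have h1 : HasFDerivAt d (fderiv ℝ d x) (AffineMap.lineMap x z (0:ℝ)) := by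
      simpa using (hdiff x).hasFDerivAt
    exact h1.comp_hasDerivAt 0 AffineMap.hasDerivAt_lineMap
  have h := hc.slope_le_of_hasDerivAt (Set.mem_univ 0) (Set.mem_univ 1) one_pos hd
  simp [slope] at h
  rw [map_sub]
  linarith

lemma aux_num (b Q : ℝ) (hQ : 0 ≤ Q)
    (h : ∀ t : ℝ, 0 < t → t ≤ 1 → 0 ≤ 2 * t * b + t ^ 2 * Q) : 0 ≤ b := by
  by_contra hb
  push Not at hb
  have hp : 0 < Q - b := by linarith
  have ht : 0 < -b / (Q - b) := div_pos (by linarith) hp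
  have h1 := h _ ht (by rw [div_le_one hp]; linarith)
  have h2 : -b / (Q - b) * (Q - b) = -b := div_mul_cancel₀ _ hp.ne'
  set t := -b / (Q - b)
  have h3 : 0 ≤ t * (2 * b + t * Q) := by nlinarith
  have h4 := nonneg_of_mul_nonneg_right h3 ht
  nlinarith

open Matrix in
lemma ipV_eq {m : ℕ} (x y : Fin m → ℝ) : ipV x y = x ⬝ᵥ y := rfl

/-- one-step linear contraction of dual suboptimality:
under the error bound at `λ`, `f* − d(λ⁺) ≤ [4(1+κ̄)/(1+4(1+κ̄))] (f* − d(λ))`. -/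
theorem one_step_contraction
    (m : ℕ) (D : Set (Fin m → ℝ)) (hDne : D.Nonempty) (hDcl : IsClosed D) (hDconv : Convex ℝ D)
    (W : Matrix (Fin m) (Fin m) ℝ) (hWsym : W.IsSymm) (hWpd : W.PosDef)
    (d : (Fin m → ℝ) → ℝ) (hconc : ConcaveOn ℝ Set.univ d)
    (gradD : (Fin m → ℝ) → (Fin m → ℝ))
    (hdiff : Differentiable ℝ d)
    (hgrad : ∀ x v, fderiv ℝ d x v = ipV (gradD x) v)
    (hdescent : ∀ lam ∈ D, ∀ mu ∈ D,
      d lam ≥ d mu + ipV (gradD mu) (lam - mu) - 1 / 2 * (mNorm W (lam - mu)) ^ 2)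
    (projD : (Fin m → ℝ) → (Fin m → ℝ))
    (hprojD : ∀ x, projD x ∈ D ∧ ∀ s ∈ D, mNorm W (projD x - x) ≤ mNorm W (s - x))
    (fstar : ℝ) (Lstar : Set (Fin m → ℝ)) (hLsub : Lstar ⊆ D)
    (hLne : Lstar.Nonempty) (hLcl : IsClosed Lstar)
    (hval : ∀ l ∈ Lstar, d l = fstar) (hub : ∀ mu ∈ D, d mu ≤ fstar)
    (lam : Fin m → ℝ) (hlamD : lam ∈ D)
    (lamb : Fin m → ℝ) (hlambmem : lamb ∈ Lstar)
    (hlambmin : ∀ s ∈ Lstar, mNorm W (lamb - lam) ≤ mNorm W (s - lam))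
    (kb : ℝ) (hkb : 0 < kb)
    (heb : mNorm W (lam - lamb) ≤
      kb * mNorm W (projD (lam + W⁻¹.mulVec (gradD lam)) - lam)) :
    fstar - d (projD (lam + W⁻¹.mulVec (gradD lam))) ≤
      4 * (1 + kb) / (1 + 4 * (1 + kb)) * (fstar - d lam) := by
  have sqN : ∀ u : Fin m → ℝ, mNorm W u ^ 2 = u ⬝ᵥ (W *ᵥ u) := by
    intro u
    refine Real.sq_sqrt ?_
    rw [ipV_eq]
    simpa using hWpd.posSemidef.dotProduct_mulVec_nonneg u
  have qn : ∀ u : Fin m → ℝ, 0 ≤ u ⬝ᵥ (W *ᵥ u) := fun u => by rw [← sqN]; positivity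
  have Bsymm : ∀ u v : Fin m → ℝ, u ⬝ᵥ (W *ᵥ v) = v ⬝ᵥ (W *ᵥ u) := by
    intro u v
    rw [Matrix.dotProduct_mulVec, ← Matrix.mulVec_transpose, hWsym.eq, dotProduct_comm]
  have hdet : IsUnit W.det := (Matrix.isUnit_iff_isUnit_det W).1 hWpd.isUnit
  have hWi : ∀ g : Fin m → ℝ, W *ᵥ (W⁻¹ *ᵥ g) = g := by
    intro g
    rw [Matrix.mulVec_mulVec, Matrix.mul_nonsing_inv _ hdet, Matrix.one_mulVec]
  obtain ⟨hyD, hymin⟩ := hprojD (lam + W⁻¹ *ᵥ (gradD lam))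
  have hg := aux_grad d hconc hdiff lam lamb
  rw [hgrad, ipV_eq, hval _ hlambmem] at hg
  set p := lam + W⁻¹ *ᵥ (gradD lam) with hp
  set y := projD p
  have hdes := hdescent y hyD lam hlamD
  rw [sqN, ipV_eq] at hdes
  have nn : ∀ u : Fin m → ℝ, 0 ≤ mNorm W u := fun u => Real.sqrt_nonneg _
  have expand : ∀ (a b : Fin m → ℝ) (t : ℝ), (a + t • b) ⬝ᵥ (W *ᵥ (a + t • b)) =
      a ⬝ᵥ (W *ᵥ a) + 2 * t * (a ⬝ᵥ (W *ᵥ b)) + t ^ 2 * (b ⬝ᵥ (W *ᵥ b)) := by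
    intro a b t
    simp only [Matrix.mulVec_add, Matrix.mulVec_smul, add_dotProduct, dotProduct_add,
      smul_dotProduct, dotProduct_smul, smul_eq_mul, Bsymm b a]
    ring
  have vi : ∀ s ∈ D, 0 ≤ (y - p) ⬝ᵥ (W *ᵥ (s - y)) := by
    intro s hs
    refine aux_num _ _ (qn (s - y)) fun t ht ht1 => ?_
    have hm : y + t • (s - y) ∈ D := hDconv.add_smul_sub_mem hyD hs ⟨ht.le, ht1⟩
    have h1 := pow_le_pow_left₀ (nn _) (hymin _ hm) 2
    rw [sqN, sqN, show y + t • (s - y) - p = (y - p) + t • (s - y) by abel, expand] at h1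
    linarith
  have vi2 : ∀ s ∈ D, gradD lam ⬝ᵥ (s - y) ≤ (y - lam) ⬝ᵥ (W *ᵥ (s - y)) := by
    intro s hs
    have h := vi s hs
    rw [show y - p = (y - lam) - W⁻¹ *ᵥ (gradD lam) by rw [hp]; abel, sub_dotProduct,
      Bsymm (W⁻¹ *ᵥ _), hWi, dotProduct_comm (s - y)] at h
    linarith
  have v1 := vi2 lam hlamD
  have v2 := vi2 lamb (hLsub hlambmem)
  have heb2 := pow_le_pow_left₀ (nn _) heb 2
  rw [mul_pow, sqN, sqN] at heb2
  have cs := qn ((lam - lamb) + kb • (y - lam))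
  rw [expand, Bsymm (lam - lamb) (y - lam)] at cs
  have e1 : lam - y = -(y - lam) := by abel
  have e2 : lamb - y = -(lam - lamb) - (y - lam) := by abel
  have e3 : lamb - lam = -(lam - lamb) := by abel
  rw [e1, Matrix.mulVec_neg, dotProduct_neg, dotProduct_neg] at v1
  rw [e2, Matrix.mulVec_sub, Matrix.mulVec_neg, dotProduct_sub _ (-(lam - lamb)),
    dotProduct_sub _ (-(W *ᵥ (lam - lamb))), dotProduct_neg, dotProduct_neg] at v2
  rw [e3, dotProduct_neg] at hg
  have hr := qn (y - lam)
  generalize (y - lam) ⬝ᵥ (W *ᵥ (y - lam)) = R at *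
  generalize (y - lam) ⬝ᵥ (W *ᵥ (lam - lamb)) = C at *
  generalize gradD lam ⬝ᵥ (y - lam) = G at *
  generalize gradD lam ⬝ᵥ (lam - lamb) = H at *
  generalize (lam - lamb) ⬝ᵥ (W *ᵥ (lam - lamb)) = Q at *
  have hC : 0 ≤ kb * (C + kb * R) := by nlinarith
  have hC2 := nonneg_of_mul_nonneg_right hC hkb
  have h1 : d lam + R / 2 ≤ d y := by linarith
  have h2 : fstar - d y ≤ kb * R := by linarith
  have h3 : fstar - d y ≤ 4 * (1 + kb) * (d y - d lam) := by nlinarith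
  rw [div_mul_eq_mul_div, le_div_iff₀ (by positivity)]
  linarith
end
end

section
/- Let W be a (p+q)×(p+q) diagonal matrix with positive diagonal entries and D = ℝ^p × ℝ^q_{≥0}. For any λ ∈ D and any v ∈ ℝ^{p+q}, let λ⁺ = [λ + W⁻¹v]_D be the Euclidean projection of λ + W⁻¹v onto D (which coincides with the W-norm projection since W is diagonal). Then ‖[v]_D‖²_{W⁻¹} ≤ ‖λ − λ⁺‖²_W, where [v]_D is the Euclidean projection of v onto D, i.e. the vector whose first p coordinates equal those of v and whose last q coordinates are the positive parts max(vᵢ, 0). -/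
noncomputable section
open Finset

/-- for diagonal positive `W`, `λ ∈ D = ℝ^p × ℝ^q_{≥0}` and any `v`,
with `λ⁺ = [λ + W⁻¹v]_D`, one has `‖[v]_D‖²_{W⁻¹} ≤ ‖λ − λ⁺‖²_W`. -/
theorem projected_residual_bound
    (p q : ℕ) (W : Fin (p + q) → ℝ) (hW : ∀ i, 0 < W i)
    (lam : Fin (p + q) → ℝ) (hlam : lam ∈ Dpq p q)
    (v : Fin (p + q) → ℝ) :
    (wNorm (fun i => (W i)⁻¹) (projDpq p q v)) ^ 2 ≤
      (wNorm W (lam - projDpq p q (lam + fun i => (W i)⁻¹ * v i))) ^ 2 := by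
  unfold wNorm
  refine pow_le_pow_left₀ (Real.sqrt_nonneg _) (Real.sqrt_le_sqrt ?_) 2
  refine Finset.sum_le_sum fun i _ => ?_
  have hw := hW i
  have key : W i * ((W i)⁻¹ * v i) ^ 2 = (W i)⁻¹ * (v i) ^ 2 := by
    field_simp
  simp only [projDpq, Pi.sub_apply, Pi.add_apply]
  by_cases h : (i : ℕ) < p
  · simp only [h, if_true]
    rw [← key]
    apply le_of_eq
    ring
  · simp only [h, if_false]
    have hl : 0 ≤ lam i := hlam i (not_lt.mp h)
    rcases le_total (v i) 0 with hv | hv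
    · rw [max_eq_right hv]
      have : 0 ≤ W i * (lam i - max (lam i + (W i)⁻¹ * v i) 0) ^ 2 := by positivity
      simpa using this
    · have h2 : 0 ≤ lam i + (W i)⁻¹ * v i := by positivity
      rw [max_eq_left hv, max_eq_left h2, ← key]
      apply le_of_eq
      ring
end
end

section
/- Let f : ℝⁿ → ℝ be σ_f-strongly convex, G an m×n real matrix, g ∈ ℝ^m, D ⊆ ℝ^m a convex set, L(z,λ) = f(z) + ⟨λ, Gz − g⟩, and d(λ) = min_{z∈ℝⁿ} L(z,λ) with unique minimizer z(λ). Suppose λ* ∈ D and z* ∈ ℝⁿ satisfy: z* = z(λ*), d(λ*) = f* where f* = f(z*), and ⟨λ, Gz* − g⟩ ≤ 0 for all λ ∈ D. Then for every λ ∈ D: (σ_f/2)·‖z(λ) − z*‖² ≤ f* − d(λ), where ‖·‖ is the Euclidean norm. -/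
noncomputable section
open Finset

lemma eNorm_sq_aux {m : ℕ} (x : Fin m → ℝ) : (eNorm x) ^ 2 = ∑ i, (x i) ^ 2 := by
  unfold eNorm
  exact Real.sq_sqrt (Finset.sum_nonneg fun i _ => sq_nonneg _)

lemma eNorm_comb_aux {m : ℕ} (x y : Fin m → ℝ) (t : ℝ) :
    (eNorm ((1 - t) • x + t • y)) ^ 2 =
      (1 - t) * (eNorm x) ^ 2 + t * (eNorm y) ^ 2 - t * (1 - t) * (eNorm (x - y)) ^ 2 := by
  simp only [eNorm_sq_aux, Finset.mul_sum, ← Finset.sum_add_distrib, ← Finset.sum_sub_distrib]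
  refine Finset.sum_congr rfl fun i _ => ?_
  simp only [Pi.add_apply, Pi.smul_apply, Pi.sub_apply, smul_eq_mul]
  ring

lemma ipV_comb_aux {m n : ℕ} (G : Matrix (Fin m) (Fin n) ℝ) (g l : Fin m → ℝ)
    (x y : Fin n → ℝ) (t : ℝ) :
    ipV l (G.mulVec ((1 - t) • x + t • y) - g) =
      (1 - t) * ipV l (G.mulVec x - g) + t * ipV l (G.mulVec y - g) := by
  unfold ipV
  rw [Matrix.mulVec_add, Matrix.mulVec_smul, Matrix.mulVec_smul]
  simp only [Finset.mul_sum, ← Finset.sum_add_distrib]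
  refine Finset.sum_congr rfl fun i _ => ?_
  simp only [Pi.add_apply, Pi.smul_apply, Pi.sub_apply, smul_eq_mul]
  ring

/-- `(σ_f/2)‖z(λ) − z*‖² ≤ f* − d(λ)` for every `λ ∈ D`. -/
theorem primal_distance_bound
    (n m : ℕ) (σf : ℝ) (hσf : 0 < σf)
    (f : (Fin n → ℝ) → ℝ)
    (hconv : ConvexOn ℝ Set.univ (fun z => f z - σf / 2 * (eNorm z) ^ 2))
    (G : Matrix (Fin m) (Fin n) ℝ) (g : Fin m → ℝ)
    (D : Set (Fin m → ℝ)) (hDconv : Convex ℝ D)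
    (Lag : (Fin n → ℝ) → (Fin m → ℝ) → ℝ)
    (hLag : ∀ z lam, Lag z lam = f z + ipV lam (G.mulVec z - g))
    (zmin : (Fin m → ℝ) → (Fin n → ℝ))
    (hzmin : ∀ lam z, Lag (zmin lam) lam ≤ Lag z lam)
    (d : (Fin m → ℝ) → ℝ) (hd : ∀ lam, d lam = Lag (zmin lam) lam)
    (lstar : Fin m → ℝ) (hlstarD : lstar ∈ D)
    (zstar : Fin n → ℝ) (hzstar : zstar = zmin lstar)
    (fstar : ℝ) (hfstar : fstar = f zstar) (hdstar : d lstar = fstar)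
    (hfeas : ∀ lam ∈ D, ipV lam (G.mulVec zstar - g) ≤ 0) :
    ∀ lam ∈ D, σf / 2 * (eNorm (zmin lam - zstar)) ^ 2 ≤ fstar - d lam := by
  intro lam hlam
  have hB : Lag zstar lam ≤ fstar := by
    rw [hLag, hfstar]; linarith [hfeas lam hlam]
  rw [hd lam]
  set w := zmin lam with hw
  have h0 : Lag w lam ≤ Lag zstar lam := hzmin lam zstar
  have key : ∀ t : ℝ, 0 < t → t ≤ 1 →
      (1 - t) * (σf / 2 * (eNorm (w - zstar)) ^ 2) ≤ Lag zstar lam - Lag w lam := by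
    intro t ht ht1
    have hc := hconv.2 (Set.mem_univ w) (Set.mem_univ zstar) (sub_nonneg.2 ht1) ht.le
      (by ring : (1 - t) + t = 1)
    have hm := hzmin lam ((1 - t) • w + t • zstar)
    rw [← hw] at hm
    simp only [smul_eq_mul] at hc
    rw [eNorm_comb_aux] at hc
    simp only [hLag] at hm ⊢
    rw [ipV_comb_aux] at hm
    refine le_of_mul_le_mul_left ?_ ht
    linarith
  by_contra hcon
  have hlt : Lag zstar lam - Lag w lam < σf / 2 * (eNorm (w - zstar)) ^ 2 := by
    linarith [not_le.1 hcon]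
  generalize σf / 2 * (eNorm (w - zstar)) ^ 2 = A at key hlt
  have hA : 0 < A := by linarith
  have := key ((A - (Lag zstar lam - Lag w lam)) / (2 * A))
    (div_pos (by linarith) (by linarith)) ((div_le_one (by linarith)).2 (by linarith))
  have e : (1 - (A - (Lag zstar lam - Lag w lam)) / (2 * A)) * A
      = A - (A - (Lag zstar lam - Lag w lam)) / 2 := by
    field_simp
  linarith
end
end

section
/- Let f : ℝⁿ → ℝ be σ_f-strongly convex, G a (p+q)×n real matrix, g ∈ ℝ^{p+q}, D = ℝ^p × ℝ^q_{≥0}, L(z,λ) = f(z) + ⟨λ, Gz − g⟩, and d(λ) = min_{z∈ℝⁿ} L(z,λ) with unique minimizer z(λ). Let W be a (p+q)×(p+q) diagonal matrix with positive diagonal entries and suppose λ* ∈ D satisfies d(λ*) = f*, where f* is the optimal value of the primal problem min{f(z) : the first p coordinates of Gz − g are zero and the last q coordinates are ≤ 0}. Then for every λ ∈ D: f* ≤ f(z(λ)) + ‖λ*‖_W · ‖[G z(λ) − g]_D‖_{W⁻¹}, where [v]_D is the Euclidean projection of v onto D (first p coordinates unchanged, positive parts of the last q coordinates). -/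
noncomputable section
open Finset

/-- `f* ≤ f(z(λ)) + ‖λ*‖_W ‖[Gz(λ) − g]_D‖_{W⁻¹}` for every `λ ∈ D`. -/
theorem primal_suboptimality_lower_bound
    (n p q : ℕ) (σf : ℝ) (hσf : 0 < σf)
    (f : (Fin n → ℝ) → ℝ)
    (hconv : ConvexOn ℝ Set.univ (fun z => f z - σf / 2 * (eNorm z) ^ 2))
    (G : Matrix (Fin (p + q)) (Fin n) ℝ) (g : Fin (p + q) → ℝ)
    (Lag : (Fin n → ℝ) → (Fin (p + q) → ℝ) → ℝ)
    (hLag : ∀ z lam, Lag z lam = f z + ipV lam (G.mulVec z - g))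
    (zmin : (Fin (p + q) → ℝ) → (Fin n → ℝ))
    (hzmin : ∀ lam z, Lag (zmin lam) lam ≤ Lag z lam)
    (d : (Fin (p + q) → ℝ) → ℝ) (hd : ∀ lam, d lam = Lag (zmin lam) lam)
    (W : Fin (p + q) → ℝ) (hW : ∀ i, 0 < W i)
    (lstar : Fin (p + q) → ℝ) (hlstarD : lstar ∈ Dpq p q)
    (fstar : ℝ) (hdstar : d lstar = fstar)
    (hprimal : IsGLB (f '' {z | ∀ i : Fin (p + q),
      ((i : ℕ) < p → (G.mulVec z - g) i = 0) ∧ (p ≤ (i : ℕ) → (G.mulVec z - g) i ≤ 0)}) fstar) :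
    ∀ lam ∈ Dpq p q,
      fstar ≤ f (zmin lam) +
        wNorm W lstar * wNorm (fun i => (W i)⁻¹) (projDpq p q (G.mulVec (zmin lam) - g)) := by
  intro lam _
  set v := G.mulVec (zmin lam) - g with hv
  have h1 : fstar ≤ f (zmin lam) + ipV lstar v := by
    rw [← hdstar, hd, hv, ← hLag]
    exact hzmin lstar (zmin lam)
  have h2 : ipV lstar v ≤ ipV lstar (projDpq p q v) := by
    unfold ipV
    refine Finset.sum_le_sum fun i _ => ?_
    unfold projDpq
    by_cases hi : (i : ℕ) < p
    · simp [hi]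
    · simp only [hi, if_false]
      exact mul_le_mul_of_nonneg_left (le_max_left _ _) (hlstarD i (not_lt.mp hi))
  have h3 : ∀ u : Fin (p + q) → ℝ,
      ipV lstar u ≤ wNorm W lstar * wNorm (fun i => (W i)⁻¹) u := by
    intro u
    have h := Real.sum_mul_le_sqrt_mul_sqrt Finset.univ
      (fun i => Real.sqrt (W i) * lstar i) (fun i => (Real.sqrt (W i))⁻¹ * u i)
    have e1 : ∀ i, Real.sqrt (W i) * lstar i * ((Real.sqrt (W i))⁻¹ * u i) = lstar i * u i := by
      intro i
      have := (Real.sqrt_pos.mpr (hW i)).ne'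
      field_simp
    have e2 : ∀ i, Real.sqrt (W i) ^ 2 = W i := fun i => Real.sq_sqrt (hW i).le
    simp only [e1, mul_pow, inv_pow, e2] at h
    exact h
  linarith [h3 (projDpq p q v)]
end
end

section
/- Let D ⊆ ℝ^m be a nonempty closed convex set, W an m×m symmetric positive definite matrix, and d : ℝ^m → ℝ differentiable with ‖∇d(λ) − ∇d(ω)‖_{W⁻¹} ≤ ‖λ − ω‖_W for all λ, ω ∈ D. Then for all λ, ω ∈ D: ⟨∇d(ω) − ∇d(λ), λ − ω⟩ ≤ 2 · ‖∇⁺d(λ) − ∇⁺d(ω)‖_W · ‖λ − ω‖_W. -/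
noncomputable section
open Finset

theorem aux_cs_s15 {V : Type*} [AddCommGroup V] [Module ℝ V] (B : V →ₗ[ℝ] V →ₗ[ℝ] ℝ)
    (hs : ∀ x y, B x y = B y x) (hn : ∀ x, 0 ≤ B x x) (x y : V) :
    |B x y| ≤ √(B x x) * √(B y y) := by
  have h : discrim (B y y) (2 * B x y) (B x x) ≤ 0 := by
    apply discrim_le_zero
    intro t
    have := hn (x + t • y)
    simp only [map_add, map_smul, LinearMap.add_apply, LinearMap.smul_apply, smul_eq_mul] at this
    rw [hs y x] at this
    linarith
  rw [discrim] at h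
  rw [← Real.sqrt_mul (hn x)]
  apply Real.abs_le_sqrt
  linarith

theorem aux_var {V : Type*} [AddCommGroup V] [Module ℝ V] (B : V →ₗ[ℝ] V →ₗ[ℝ] ℝ)
    (hs : ∀ x y, B x y = B y x) (hn : ∀ x, 0 ≤ B x x) (D : Set V) (hD : Convex ℝ D)
    (x p : V) (hp : p ∈ D) (hmin : ∀ s ∈ D, √(B (p - x) (p - x)) ≤ √(B (s - x) (s - x)))
    (s : V) (hsD : s ∈ D) : 0 ≤ B (p - x) (s - p) := by
  have key : ∀ t : ℝ, 0 < t → t ≤ 1 → 0 ≤ 2 * B (p - x) (s - p) + t * B (s - p) (s - p) := by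
    intro t h0 h1
    have hm : p + t • (s - p) ∈ D := hD.add_smul_sub_mem hp hsD ⟨h0.le, h1⟩
    have h := hmin _ hm
    rw [Real.sqrt_le_sqrt_iff (hn _)] at h
    have e : p + t • (s - p) - x = (p - x) + t • (s - p) := by abel
    rw [e] at h
    generalize p - x = a at *
    generalize s - p = b at *
    simp only [map_add, map_smul, LinearMap.add_apply, LinearMap.smul_apply, smul_eq_mul] at h
    rw [hs b a] at h
    have : 0 ≤ t * (2 * B a b + t * B b b) := by linarith
    exact nonneg_of_mul_nonneg_right this h0
  by_contra! hneg
  have hC := hn (s - p)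
  set b := B (p - x) (s - p)
  set c := B (s - p) (s - p)
  have hd : 0 < c + 1 - b := by linarith
  have h := key (-b / (c + 1 - b)) (div_pos (by linarith) hd) (by rw [div_le_one hd]; linarith)
  have h2 : -b / (c + 1 - b) * c ≤ -b := by
    rw [div_mul_eq_mul_div, div_le_iff₀ hd]
    nlinarith
  linarith

theorem aux_main {V : Type*} [AddCommGroup V] [Module ℝ V] (B : V →ₗ[ℝ] V →ₗ[ℝ] ℝ)
    (hs : ∀ x y, B x y = B y x) (hn : ∀ x, 0 ≤ B x x) (D : Set V) (hD : Convex ℝ D)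
    (l o gl go p q : V) (hp : p ∈ D) (hq : q ∈ D)
    (hpm : ∀ s ∈ D, √(B (p - (l + gl)) (p - (l + gl))) ≤ √(B (s - (l + gl)) (s - (l + gl))))
    (hqm : ∀ s ∈ D, √(B (q - (o + go)) (q - (o + go))) ≤ √(B (s - (o + go)) (s - (o + go))))
    (hg : √(B (gl - go) (gl - go)) ≤ √(B (l - o) (l - o))) :
    B (go - gl) (l - o) ≤
      2 * √(B ((p - l) - (q - o)) ((p - l) - (q - o))) * √(B (l - o) (l - o)) := by
  have h1 := aux_var B hs hn D hD _ p hp hpm q hq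
  have h2 := aux_var B hs hn D hD _ q hq hqm p hp
  obtain ⟨r, hr⟩ : ∃ r, r = (p - l) - (q - o) := ⟨_, rfl⟩
  obtain ⟨x, hx⟩ : ∃ x, x = l - o := ⟨_, rfl⟩
  obtain ⟨u, hu⟩ : ∃ u, u = gl - go := ⟨_, rfl⟩
  have e1 : q - p = -(x + r) := by rw [hx, hr]; abel
  have e2 : p - q = x + r := by rw [hx, hr]; abel
  have e3 : go - gl = -u := by rw [hu]; abel
  have h3 : 0 ≤ B (u - r) (x + r) := by
    have e : u - r = (q - (o + go)) - (p - (l + gl)) := by rw [hu, hr]; abel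
    rw [e, map_sub, LinearMap.sub_apply]
    rw [e1, map_neg] at h1
    rw [e2] at h2
    linarith
  rw [← hr, ← hx, e3]
  rw [← hu, ← hx] at hg
  have c1 := (abs_le.1 (aux_cs_s15 B hs hn r u)).2
  have c2 := (abs_le.1 (aux_cs_s15 B hs hn r x)).1
  have c3 := mul_le_mul_of_nonneg_left hg (Real.sqrt_nonneg (B r r))
  have c4 := hn r
  simp only [map_add, map_sub, map_neg, LinearMap.sub_apply, LinearMap.neg_apply] at h3 ⊢
  rw [hs u r] at h3
  linarith

/-- Lemma 5 of the paper:
`⟨∇d(ω) − ∇d(λ), λ − ω⟩ ≤ 2‖∇⁺d(λ) − ∇⁺d(ω)‖_W ‖λ − ω‖_W` for all `λ, ω ∈ D`. -/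
theorem gradient_residual_inequality
    (m : ℕ) (D : Set (Fin m → ℝ)) (hDne : D.Nonempty) (hDcl : IsClosed D) (hDconv : Convex ℝ D)
    (W : Matrix (Fin m) (Fin m) ℝ) (hWsym : W.IsSymm) (hWpd : W.PosDef)
    (d : (Fin m → ℝ) → ℝ) (gradD : (Fin m → ℝ) → (Fin m → ℝ))
    (hdiff : Differentiable ℝ d)
    (hgrad : ∀ x v, fderiv ℝ d x v = ipV (gradD x) v)
    (hnonexp : ∀ lam ∈ D, ∀ om ∈ D, mNorm W⁻¹ (gradD lam - gradD om) ≤ mNorm W (lam - om))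
    (projD : (Fin m → ℝ) → (Fin m → ℝ))
    (hprojD : ∀ x, projD x ∈ D ∧ ∀ s ∈ D, mNorm W (projD x - x) ≤ mNorm W (s - x)) :
    ∀ lam ∈ D, ∀ om ∈ D,
      ipV (gradD om - gradD lam) (lam - om) ≤
        2 * mNorm W ((projD (lam + W⁻¹.mulVec (gradD lam)) - lam)
            - (projD (om + W⁻¹.mulVec (gradD om)) - om)) * mNorm W (lam - om) := by
  intro lam hlam om hom
  have hB : ∀ x y, Matrix.toBilin' W x y = ipV x (W.mulVec y) := fun x y =>
    Matrix.toBilin'_apply' W x y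
  have hs : ∀ x y, Matrix.toBilin' W x y = Matrix.toBilin' W y x := by
    intro x y
    rw [Matrix.toBilin'_apply', Matrix.toBilin'_apply', Matrix.dotProduct_mulVec,
      ← Matrix.mulVec_transpose, hWsym.eq, dotProduct_comm]
  have hn : ∀ x, 0 ≤ Matrix.toBilin' W x x := by
    intro x
    rw [Matrix.toBilin'_apply']
    simpa using hWpd.posSemidef.dotProduct_mulVec_nonneg x
  have hu : IsUnit W.det := (Matrix.isUnit_iff_isUnit_det W).1 hWpd.isUnit
  have hW : ∀ v, W.mulVec (W⁻¹.mulVec v) = v := by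
    intro v
    rw [Matrix.mulVec_mulVec, Matrix.mul_nonsing_inv _ hu, Matrix.one_mulVec]
  have hm : ∀ x, mNorm W x = √(Matrix.toBilin' W x x) := fun x => by rw [hB, mNorm]
  have hc : ∀ x y : Fin m → ℝ, ipV x y = ipV y x := fun x y => dotProduct_comm x y
  have hg := hnonexp lam hlam om hom
  have e1 : mNorm W⁻¹ (gradD lam - gradD om)
      = mNorm W (W⁻¹.mulVec (gradD lam) - W⁻¹.mulVec (gradD om)) := by
    rw [← Matrix.mulVec_sub, mNorm, mNorm, hW, hc]
  have e2 : ipV (gradD om - gradD lam) (lam - om)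
      = Matrix.toBilin' W (W⁻¹.mulVec (gradD om) - W⁻¹.mulVec (gradD lam)) (lam - om) := by
    rw [← Matrix.mulVec_sub, hs, hB, hW, hc]
  rw [e1] at hg
  rw [e2]
  simp only [hm] at hg hprojD ⊢
  exact aux_main (Matrix.toBilin' W) hs hn D hDconv lam om _ _ _ _ (hprojD _).1 (hprojD _).1
    (hprojD _).2 (hprojD _).2 hg
end
end

section
/- Let ψ : ℝⁿ → ℝ be σ-strongly convex and differentiable, G an m×n real matrix, g ∈ ℝ^m, and define d(λ) = −ψ(−Gᵀλ) − ⟨g, λ⟩ for λ ∈ ℝ^m. Then for all λ, λ̄ ∈ ℝ^m: σ · ‖Gᵀλ − Gᵀλ̄‖² ≤ ⟨∇d(λ̄) − ∇d(λ), λ − λ̄⟩, where ‖·‖ is the Euclidean norm. -/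
noncomputable section
open Finset

/-- strong monotonicity of the dual gradient along `Gᵀ`:
`σ‖Gᵀλ − Gᵀλ̄‖² ≤ ⟨∇d(λ̄) − ∇d(λ), λ − λ̄⟩`. -/
theorem dual_gradient_strong_monotonicity
    (n m : ℕ) (σ : ℝ) (hσ : 0 < σ)
    (ψ : (Fin n → ℝ) → ℝ)
    (hconv : ConvexOn ℝ Set.univ (fun x => ψ x - σ / 2 * (eNorm x) ^ 2))
    (hdiff : Differentiable ℝ ψ)
    (G : Matrix (Fin m) (Fin n) ℝ) (g : Fin m → ℝ)
    (d : (Fin m → ℝ) → ℝ)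
    (hd : ∀ lam, d lam = -ψ (-(G.transpose.mulVec lam)) - ipV g lam)
    (gradD : (Fin m → ℝ) → (Fin m → ℝ))
    (hgradD : ∀ lam v, fderiv ℝ d lam v = ipV (gradD lam) v) :
    ∀ lam lamb : Fin m → ℝ,
      σ * (eNorm (G.transpose.mulVec lam - G.transpose.mulVec lamb)) ^ 2 ≤
        ipV (gradD lamb - gradD lam) (lam - lamb) := by
  intro lam lamb
  set a := G.transpose.mulVec lamb with ha
  set w := G.transpose.mulVec (lam - lamb) with hw
  have hw' : G.transpose.mulVec lam - a = w := by
    rw [hw, Matrix.mulVec_sub]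
  rw [hw']
  have hsq : ∀ {k : ℕ} (x : Fin k → ℝ), eNorm x ^ 2 = ∑ i, (x i) ^ 2 := fun x =>
    Real.sq_sqrt (Finset.sum_nonneg fun i _ => sq_nonneg _)
  rw [hsq]
  simp only [hsq] at hconv
  have hline : ∀ t : ℝ, G.transpose.mulVec (lamb + t • (lam - lamb)) = a + t • w := by
    intro t
    rw [Matrix.mulVec_add, Matrix.mulVec_smul]
  have hdd : Differentiable ℝ d := by
    have h1 : d = fun l => -ψ (-(Matrix.mulVecLin G.transpose).toContinuousLinearMap l)
        - ∑ i, g i * l i := by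
      funext l
      rw [hd]
      rfl
    rw [h1]
    have h2 : Differentiable ℝ (fun l : Fin m → ℝ =>
        ψ (-(Matrix.mulVecLin G.transpose).toContinuousLinearMap l)) :=
      hdiff.comp (ContinuousLinearMap.differentiable _).neg
    exact h2.neg.sub (by fun_prop)
  let k : ℝ → ℝ := fun t => -d (lamb + t • (lam - lamb)) - σ / 2 * ∑ i, (a i + t * w i) ^ 2
  have hk : ∀ t, HasDerivAt k
      (-ipV (gradD (lamb + t • (lam - lamb))) (lam - lamb)
        - σ / 2 * ∑ i, 2 * (a i + t * w i) * w i) t := by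
    intro t
    have h1 : HasDerivAt (fun t : ℝ => lamb + t • (lam - lamb)) (lam - lamb) t := by
      simpa using ((hasDerivAt_id t).smul_const (lam - lamb)).const_add lamb
    have h2 := (hdd (lamb + t • (lam - lamb))).hasFDerivAt.comp_hasDerivAt t h1
    rw [hgradD] at h2
    have h3 : HasDerivAt (fun t : ℝ => ∑ i, (a i + t * w i) ^ 2)
        (∑ i, 2 * (a i + t * w i) * w i) t := by
      refine HasDerivAt.fun_sum fun i _ => ?_
      have h4 : HasDerivAt (fun t : ℝ => a i + t * w i) (w i) t := by
        simpa using ((hasDerivAt_id t).mul_const (w i)).const_add (a i)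
      simpa using h4.fun_pow 2
    exact h2.neg.sub (h3.const_mul (σ / 2))
  have hkf : ∀ t, k t = (ψ (-(a + t • w)) - σ / 2 * ∑ i, ((-(a + t • w)) i) ^ 2)
      + (ipV g lamb + t * ipV g (lam - lamb)) := by
    intro t
    have h1 : ipV g (lamb + t • (lam - lamb)) = ipV g lamb + t * ipV g (lam - lamb) := by
      simp only [ipV, Finset.mul_sum, ← Finset.sum_add_distrib]
      refine Finset.sum_congr rfl fun i _ => ?_
      simp only [Pi.add_apply, Pi.smul_apply, smul_eq_mul]
      ring
    have h2 : ∀ i, ((-(a + t • w)) i) ^ 2 = (a i + t * w i) ^ 2 := by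
      intro i
      simp only [Pi.neg_apply, Pi.add_apply, Pi.smul_apply, smul_eq_mul]
      ring
    simp only [k, hd, hline, h1, h2]
    ring
  have hkc : ConvexOn ℝ Set.univ k := by
    refine ⟨convex_univ, fun x _ y _ p q hp hq hpq => ?_⟩
    have h := hconv.2 (Set.mem_univ (-(a + x • w))) (Set.mem_univ (-(a + y • w))) hp hq hpq
    have e : p • (-(a + x • w)) + q • (-(a + y • w)) = -(a + (p • x + q • y) • w) := by
      funext i
      simp only [Pi.neg_apply, Pi.add_apply, Pi.smul_apply, smul_eq_mul]
      linear_combination (-(a i)) * hpq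
    rw [e] at h
    rw [hkf, hkf x, hkf y]
    simp only [smul_eq_mul] at h ⊢
    have e2 : ipV g lamb = p * ipV g lamb + q * ipV g lamb := by
      linear_combination (-(ipV g lamb)) * hpq
    linarith
  have hm := hkc.monotoneOn_deriv (fun x _ => (hk x).differentiableAt)
    (Set.mem_univ 0) (Set.mem_univ 1) zero_le_one
  rw [(hk 0).deriv, (hk 1).deriv] at hm
  have e1 : lamb + (1 : ℝ) • (lam - lamb) = lam := by simp
  have e0 : lamb + (0 : ℝ) • (lam - lamb) = lamb := by simp
  rw [e1, e0] at hm
  have e3 : ipV (gradD lamb - gradD lam) (lam - lamb)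
      = ipV (gradD lamb) (lam - lamb) - ipV (gradD lam) (lam - lamb) := by
    simp only [ipV, ← Finset.sum_sub_distrib]
    refine Finset.sum_congr rfl fun i _ => ?_
    simp only [Pi.sub_apply]
    ring
  have e4 : ∑ i, 2 * (a i + 1 * w i) * w i
      = ∑ i, 2 * (a i + 0 * w i) * w i + 2 * ∑ i, w i ^ 2 := by
    rw [Finset.mul_sum, ← Finset.sum_add_distrib]
    refine Finset.sum_congr rfl fun i _ => ?_
    ring
  rw [e4] at hm
  rw [e3]
  linarith
end
end
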